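/- Let T=(V,p) be a leafless directed tree with root ω, let k ≥ 1, set W = {v ∈ V : p^k(v) ≠ ω}, and suppose nonzero complex weights λ_v are given for all v ∈ W. Then the following are equivalent: (a) there exist weights λ_v for v ∈ V \ W such that the weighted shift S_λ on T with the combined weights λ = (λ_v)_{v∈V} is proper, bounded and subnormal; (b) the set Chi^⟨k⟩(ω) is at most countable, for every v ∈ Chi^⟨k⟩(ω) the weighted shift S_{λ→_v} is proper and admits a subnormal k-step backward extension, and sup{‖S_{λ→_v}‖ : v ∈ Chi^⟨k⟩(ω)} < ∞. -/

import Mathlib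

open scoped ENNReal Classical
noncomputable section

universe u

namespace ShiftsPaper

/-- ℓ²(V) over ℂ. -/
abbrev Hs (V : Type u) : Type u := lp (fun _ : V => ℂ) 2

/-- canonical orthonormal basis vector -/
def ev {V : Type u} (v : V) : Hs V := lp.single 2 v 1

/-- A directed forest: a nonempty vertex set together with a parent function `p`
such that any vertex lying on a `p`-cycle is a fixed point of `p`. -/
def IsDirectedForest {V : Type u} (p : V → V) : Prop :=
  Nonempty V ∧ ∀ n : ℕ, 1 ≤ n → ∀ v : V, p^[n] v = v → p v = v

def rootSet {V : Type u} (p : V → V) : Set V := {v | p v = v}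

def children {V : Type u} (p : V → V) (v : V) : Set V := {u | p u = v ∧ u ≠ v}

/-- the set of `k`-th children `Chi^⟨k⟩(v)` -/
def childrenIter {V : Type u} (p : V → V) : ℕ → V → Set V
  | 0, v => {v}
  | k + 1, v => {u | p^[k + 1] u = v ∧ p^[k] u ≠ v}

/-- descendants -/
def des {V : Type u} (p : V → V) (v : V) : Set V := ⋃ n : ℕ, childrenIter p n v

lemma self_mem_des {V : Type u} (p : V → V) (v : V) : v ∈ des p v :=
  Set.mem_iUnion.2 ⟨0, by simp [childrenIter]⟩

/-- `u` and `v` belong to the same tree (connected component) of the forest -/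
def sameTree {V : Type u} (p : V → V) (u v : V) : Prop :=
  ∃ m n : ℕ, p^[m] u = p^[n] v

/-- A directed tree is a connected directed forest. -/
def IsDirectedTree {V : Type u} (p : V → V) : Prop :=
  IsDirectedForest p ∧ ∀ u v : V, sameTree p u v

def Leafless {V : Type u} (p : V → V) : Prop := Function.Surjective p

def LocallyCountable {V : Type u} (p : V → V) : Prop :=
  ∀ v : V, (children p v).Countable

/-- every non-root vertex has exactly one child -/
def Forkless {V : Type u} (p : V → V) : Prop :=
  ∀ v : V, p v ≠ v → ∃! u : V, u ∈ children p v

/-- a system of weights: vanishing at the roots -/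
def WeightSystem {V : Type u} (p : V → V) (lam : V → ℂ) : Prop :=
  ∀ v : V, p v = v → lam v = 0

/-- a proper system of weights: vanishing exactly at the roots -/
def ProperWeights {V : Type u} (p : V → V) (lam : V → ℂ) : Prop :=
  ∀ v : V, lam v = 0 ↔ p v = v

/-- `S` is the (bounded) weighted shift on the forest `(V, p)` with weights `lam`:
`(S f)(v) = lam v • f (p v)`. -/
def IsWeightedShift {V : Type u} (p : V → V) (lam : V → ℂ)
    (S : Hs V →L[ℂ] Hs V) : Prop :=
  ∀ (f : Hs V) (v : V), (S f : ∀ _ : V, ℂ) v = lam v * (f : ∀ _ : V, ℂ) (p v)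

def Hyponormal {E : Type u} [NormedAddCommGroup E] [InnerProductSpace ℂ E]
    [CompleteSpace E] (A : E →L[ℂ] E) : Prop :=
  (ContinuousLinearMap.adjoint A ∘L A - A ∘L ContinuousLinearMap.adjoint A).IsPositive

def PowerHyponormal {E : Type u} [NormedAddCommGroup E] [InnerProductSpace ℂ E]
    [CompleteSpace E] (A : E →L[ℂ] E) : Prop :=
  ∀ n : ℕ, 1 ≤ n → Hyponormal (A ^ n)

/-- `A` is subnormal: it is the restriction of a bounded normal operator on a larger
Hilbert space to an invariant subspace. -/
def Subnormal {E : Type u} [NormedAddCommGroup E] [InnerProductSpace ℂ E]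
    [CompleteSpace E] (A : E →L[ℂ] E) : Prop :=
  ∃ (K : Type u) (_ : NormedAddCommGroup K) (_ : InnerProductSpace ℂ K)
    (_ : CompleteSpace K) (J : E →ₗᵢ[ℂ] K) (N : K →L[ℂ] K),
    IsStarNormal N ∧ ∀ x : E, N (J x) = J (A x)

/-- `μ` is a representing measure (a positive Borel measure on `[0,∞)`) for the
sequence `a`. -/
def IsRepresentingMeasure (μ : MeasureTheory.Measure ℝ) (a : ℕ → ℝ) : Prop :=
  μ (Set.Iio 0) = 0 ∧
    ∀ n : ℕ, ENNReal.ofReal (a n) = ∫⁻ x : ℝ, ENNReal.ofReal (x ^ n) ∂μ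

def IsStieltjesMomentSeq (a : ℕ → ℝ) : Prop :=
  (∀ n, 0 ≤ a n) ∧ ∃ μ : MeasureTheory.Measure ℝ, IsRepresentingMeasure μ a

/-- parent function of the `k`-step backward extension `T⟨k⟩`; the new vertices
`ω_1, …, ω_k` are encoded as `Sum.inr ⟨0⟩, …, Sum.inr ⟨k-1⟩`. -/
def extParent {V : Type u} (p : V → V) (ω : V) (k : ℕ) :
    V ⊕ Fin k → V ⊕ Fin k
  | Sum.inl v =>
      if v = ω then (if h : 0 < k then Sum.inr ⟨0, h⟩ else Sum.inl ω)
      else Sum.inl (p v)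
  | Sum.inr j =>
      if h : (j : ℕ) + 1 < k then Sum.inr ⟨(j : ℕ) + 1, h⟩ else Sum.inr j

/-- weights on `T⟨k⟩`: weight `mu 0 = λ'_{ω_0}` at the old root `ω`, weight
`mu (j+1) = λ'_{ω_{j+1}}` at `ω_{j+1}` for `j+1 < k`, weight `0` at the new root `ω_k`. -/
def extWeights {V : Type u} (lam : V → ℂ) (ω : V) (k : ℕ) (mu : Fin k → ℂ) :
    V ⊕ Fin k → ℂ
  | Sum.inl v => if v = ω then (if h : 0 < k then mu ⟨0, h⟩ else 0) else lam v
  | Sum.inr j => if h : (j : ℕ) + 1 < k then mu ⟨(j : ℕ) + 1, h⟩ else 0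

/-- `S` (the weighted shift with weights `lam` on a tree rooted at `ω`) admits a
subnormal `k`-step backward extension. -/
def AdmitsSubnormalBackExt {V : Type u} (p : V → V) (lam : V → ℂ) (ω : V)
    (S : Hs V →L[ℂ] Hs V) (k : ℕ) : Prop :=
  Subnormal S ∧
    ∃ mu : Fin k → ℂ, (∀ j, mu j ≠ 0) ∧
      ∃ S' : Hs (V ⊕ Fin k) →L[ℂ] Hs (V ⊕ Fin k),
        IsWeightedShift (extParent p ω k) (extWeights lam ω k mu) S' ∧ Subnormal S'

def AdmitsPowerHypoBackExt {V : Type u} (p : V → V) (lam : V → ℂ) (ω : V)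
    (S : Hs V →L[ℂ] Hs V) (k : ℕ) : Prop :=
  PowerHyponormal S ∧
    ∃ mu : Fin k → ℂ, (∀ j, mu j ≠ 0) ∧
      ∃ S' : Hs (V ⊕ Fin k) →L[ℂ] Hs (V ⊕ Fin k),
        IsWeightedShift (extParent p ω k) (extWeights lam ω k mu) S' ∧
        PowerHyponormal S'

/-- the parent function of the subforest `T|_W`. -/
def restrictParent {V : Type u} (p : V → V) (W : Set V) : W → W :=
  fun v => if h : p ↑v ∈ W then ⟨p ↑v, h⟩ else v

/-- the weights `λ→_u` on the subtree `T_(u→)` of descendants of `u`. -/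
def subWeights {V : Type u} (lam : V → ℂ) (u : V) (W : Set V) : W → ℂ :=
  fun v => if (v : V) = u then 0 else lam ↑v

/-- parent function of the rooted sum of the family `{(V j, p j)}` with roots `ω j`;
the new root is `none`. -/
def rsParent {J : Type u} {V : J → Type u} (p : ∀ j, V j → V j) (ω : ∀ j, V j) :
    Option (Σ j, V j) → Option (Σ j, V j)
  | none => none
  | some ⟨j, v⟩ => if v = ω j then none else some ⟨j, p j v⟩

/-- weights on the rooted sum: `0` at the new root, `θ j` at the old root `ω j`. -/
def rsWeights {J : Type u} {V : J → Type u} (lam : ∀ j, V j → ℂ) (ω : ∀ j, V j)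
    (θ : J → ℂ) : Option (Σ j, V j) → ℂ
  | none => 0
  | some ⟨j, v⟩ => if v = ω j then θ j else lam j v

/-- iterated weights `λ^(k)_v`. -/
def iterWeight {V : Type u} (p : V → V) (lam : V → ℂ) : ℕ → V → ℂ
  | 0, _ => 1
  | k + 1, v => iterWeight p lam k (p v) * lam v

/-- parent function `p^[k]` of the `k`-th power forest `T^k`. -/
def kPowParent {V : Type u} (p : V → V) (k : ℕ) (v : V) : V :=
  if p (p^[k - 1] v) = p^[k - 1] v then v else p^[k] v


open MeasureTheory in
/-- weighted composition operators on `L²` -/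
lemma exists_wco {Z : Type u} [MeasurableSpace Z] (ν : Measure Z) (φ : Z → Z)
    (hφ : Measurable φ) (w : Z → ℂ) (hw : Measurable w) (C : NNReal)
    (hC : ∀ g : Z → ℝ≥0∞, Measurable g →
      ∫⁻ z, ‖w z‖ₑ ^ 2 * g (φ z) ∂ν ≤ (C : ℝ≥0∞) ^ 2 * ∫⁻ z, g z ∂ν) :
    (∀ f g : Z → ℂ, f =ᵐ[ν] g → (fun z => w z * f (φ z)) =ᵐ[ν] fun z => w z * g (φ z)) ∧
    ∃ T : Lp ℂ 2 ν →L[ℂ] Lp ℂ 2 ν, ‖T‖ ≤ C ∧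
      ∀ f : Lp ℂ 2 ν, T f =ᵐ[ν] fun z => w z * f (φ z) := by
  have hcongr : ∀ f g : Z → ℂ, f =ᵐ[ν] g →
      (fun z => w z * f (φ z)) =ᵐ[ν] fun z => w z * g (φ z) := by
    intro f g hfg
    obtain ⟨N, hN, hNm, hN0⟩ := exists_measurable_superset_of_null (ae_iff.1 hfg)
    have h1 := hC (N.indicator 1) (measurable_one.indicator hNm)
    rw [lintegral_indicator_one hNm, hN0, mul_zero, nonpos_iff_eq_zero,
      lintegral_eq_zero_iff (by
        exact (hw.enorm.pow_const 2).mul ((measurable_one.indicator hNm).comp hφ))] at h1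
    filter_upwards [h1] with z hz
    by_cases hzN : φ z ∈ N
    · have : w z = 0 := by simpa [hzN] using hz
      simp [this]
    · have : f (φ z) = g (φ z) := by
        by_contra hne
        exact hzN (hN hne)
      rw [this]
  refine ⟨hcongr, ?_⟩
  have hl : ∀ f : Lp ℂ 2 ν, eLpNorm (fun z => w z * f (φ z)) 2 ν ≤ C * eLpNorm f 2 ν := by
    intro f
    have hfm : Measurable (f : Z → ℂ) := (Lp.stronglyMeasurable f).measurable
    have h2 := hC (fun z => ‖f z‖ₑ ^ 2) (hfm.enorm.pow_const 2)
    have e1 : ∀ h : Z → ℂ, eLpNorm h 2 ν = (∫⁻ z, ‖h z‖ₑ ^ 2 ∂ν) ^ (1 / (2:ℝ)) := by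
      intro h
      rw [eLpNorm_eq_lintegral_rpow_enorm_toReal (by simp) (by simp)]
      simp
    rw [e1, e1]
    calc _ = (∫⁻ z, ‖w z‖ₑ ^ 2 * ‖f (φ z)‖ₑ ^ 2 ∂ν) ^ (1 / (2:ℝ)) := by
            simp only [enorm_mul, mul_pow]
      _ ≤ ((C : ℝ≥0∞) ^ 2 * ∫⁻ z, ‖f z‖ₑ ^ 2 ∂ν) ^ (1 / (2:ℝ)) := by gcongr
      _ = _ := by
        rw [ENNReal.mul_rpow_of_nonneg _ _ (by norm_num)]
        congr 1
        rw [← ENNReal.rpow_natCast, ← ENNReal.rpow_mul]; norm_num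
  have hmem : ∀ f : Lp ℂ 2 ν, MemLp (fun z => w z * f (φ z)) 2 ν := by
    intro f
    have hfm : Measurable (f : Z → ℂ) := (Lp.stronglyMeasurable f).measurable
    refine ⟨(hw.mul (hfm.comp hφ)).aestronglyMeasurable, (hl f).trans_lt ?_⟩
    exact ENNReal.mul_lt_top ENNReal.coe_lt_top (Lp.eLpNorm_lt_top f)
  let T0 : Lp ℂ 2 ν →ₗ[ℂ] Lp ℂ 2 ν :=
    { toFun := fun f => (hmem f).toLp _
      map_add' := by
        intro f g
        rw [← MemLp.toLp_add, MemLp.toLp_eq_toLp_iff]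
        filter_upwards [hcongr _ _ (Lp.coeFn_add f g)] with z hz
        rw [hz]; simp [mul_add]
      map_smul' := by
        intro c f
        rw [RingHom.id_apply, ← MemLp.toLp_const_smul, MemLp.toLp_eq_toLp_iff]
        filter_upwards [hcongr _ _ (Lp.coeFn_smul c f)] with z hz
        rw [hz]; simp [mul_left_comm] }
  have hb : ∀ f, ‖T0 f‖ ≤ C * ‖f‖ := by
    intro f
    change ‖(hmem f).toLp _‖ ≤ _
    rw [Lp.norm_toLp, Lp.norm_def, ← ENNReal.coe_toReal, ← ENNReal.toReal_mul]
    exact ENNReal.toReal_mono (ENNReal.mul_ne_top ENNReal.coe_ne_top (Lp.eLpNorm_ne_top f)) (hl f)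
  refine ⟨T0.mkContinuous C hb, LinearMap.mkContinuous_norm_le _ C.2 _, fun f => ?_⟩
  exact (hmem f).coeFn_toLp

/-- A normal dilation of a quasinormal operator `U M`. -/
lemma normal_dilation {K : Type u} [NormedAddCommGroup K] [InnerProductSpace ℂ K]
    [CompleteSpace K] (U M P : K →L[ℂ] K)
    (hM : ContinuousLinearMap.adjoint M = M)
    (hUU : ContinuousLinearMap.adjoint U * U = P) (hUP : U * P = U) (hPM : P * M = M)
    (hUM : U * M = M * U) :
    ∃ (N : WithLp 2 (K × K) →L[ℂ] WithLp 2 (K × K)), IsStarNormal N ∧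
      ∀ x : K, N (WithLp.toLp 2 (x, 0)) = WithLp.toLp 2 (U (M x), 0) := by
  set U' := ContinuousLinearMap.adjoint U with hU'
  have hUM' : M * U' = U' * M := by
    have := congrArg ContinuousLinearMap.adjoint hUM
    simpa [ContinuousLinearMap.mul_def, ContinuousLinearMap.adjoint_comp, hM] using this
  let E := WithLp.prodContinuousLinearEquiv 2 ℂ K K
  -- entries
  let B : K →L[ℂ] K := (1 - U * U') * M
  let B' : K →L[ℂ] K := M * (1 - U * U')
  let Q := U * M
  let Q' := M * U'
  let N0 : K × K →L[ℂ] K × K :=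
    ((Q.comp (.fst ℂ K K)) + B.comp (.snd ℂ K K)).prod (Q'.comp (.snd ℂ K K))
  let N1 : K × K →L[ℂ] K × K :=
    (Q'.comp (.fst ℂ K K)).prod ((B'.comp (.fst ℂ K K)) + Q.comp (.snd ℂ K K))
  let N := (E.symm : K × K →L[ℂ] WithLp 2 (K × K)) ∘L N0 ∘L (E : WithLp 2 (K × K) →L[ℂ] K × K)
  let Na := (E.symm : K × K →L[ℂ] WithLp 2 (K × K)) ∘L N1 ∘L (E : WithLp 2 (K × K) →L[ℂ] K × K)
  have hQ' : ∀ x y, inner ℂ (Q x) y = inner ℂ x (Q' y) := by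
    intro x y
    have : Q' = ContinuousLinearMap.adjoint Q := by
      simp [Q, Q', ContinuousLinearMap.mul_def, ContinuousLinearMap.adjoint_comp, hM, hU']
    rw [this, ContinuousLinearMap.adjoint_inner_right]
  have hB' : ∀ x y, inner ℂ (B x) y = inner ℂ x (B' y) := by
    intro x y
    have : B' = ContinuousLinearMap.adjoint B := by
      have h1 : ContinuousLinearMap.adjoint (1 : K →L[ℂ] K) = 1 := star_one (K →L[ℂ] K)
      simp [B, B', ContinuousLinearMap.mul_def, ContinuousLinearMap.adjoint_comp, hM, hU', h1]
    rw [this, ContinuousLinearMap.adjoint_inner_right]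
  have hadj : Na = ContinuousLinearMap.adjoint N := by
    rw [ContinuousLinearMap.eq_adjoint_iff]
    intro x y
    have h1 : ∀ x y, inner ℂ (Q' x) y = inner ℂ x (Q y) := by
      intro x y; rw [← inner_conj_symm, ← hQ', inner_conj_symm]
    have h2 : ∀ x y, inner ℂ (B' x) y = inner ℂ x (B y) := by
      intro x y; rw [← inner_conj_symm, ← hB', inner_conj_symm]
    simp [N, Na, E, N0, N1, WithLp.prod_inner_apply, inner_add_left, inner_add_right, h1, h2]
    rw [hQ' x.snd y.snd, add_assoc]
  refine ⟨N, ⟨?_⟩, ?_⟩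
  · rw [ContinuousLinearMap.star_eq_adjoint, ← hadj]
    have a1 : Q' * Q = M * M := by
      simp only [Q, Q', ← mul_assoc]; rw [mul_assoc M U' U, hUU, mul_assoc, hPM]
    have hp : U' * U * U' = U' := by
      have := congrArg ContinuousLinearMap.adjoint hUP
      rw [← hUU] at this
      simpa [ContinuousLinearMap.mul_def, ContinuousLinearMap.adjoint_comp, hU',
        ContinuousLinearMap.comp_assoc] using this
    have hp' : U * U' * U = U := by rw [mul_assoc, hUU, hUP]
    have hc : (U * U') * M = M * (U * U') := by
      rw [mul_assoc, ← hUM', ← mul_assoc, hUM, mul_assoc]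
    have a2 : Q' * B = 0 := by
      simp only [Q', B, mul_sub, sub_mul, one_mul]
      rw [show M * U' * (U * U' * M) = M * (U' * U * U') * M by noncomm_ring, hp, mul_assoc]
      simp
    have a3 : B' * Q = 0 := by
      simp only [Q, B', mul_sub, sub_mul, mul_one]
      rw [show M * (U * U') * (U * M) = M * (U * U' * U) * M by noncomm_ring, hp', mul_assoc]
      simp
    have a4 : B' * B + Q * Q' = M * M := by
      have i1 : (1 - U * U') * (1 - U * U') = 1 - U * U' := by
        have : U * U' * (U * U') = U * U' := by rw [← mul_assoc, hp']
        simp [mul_sub, sub_mul, this]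
      have : B' * B = M * ((1 - U * U') * (1 - U * U')) * M := by
        simp only [B, B']; noncomm_ring
      rw [this, i1]
      have : Q * Q' = M * (U * U') * M := by
        simp only [Q, Q']; rw [hUM, hUM']; noncomm_ring
      rw [this]; noncomm_ring
    have a5 : Q * Q' + B * B' = M * M := by
      have hc2 : (1 - U * U') * M = M * (1 - U * U') := by
        simp [sub_mul, mul_sub, hc]
      have : B * B' = B' * B := by
        simp only [B, B']; rw [hc2]
      rw [this, add_comm, a4]
    have a6 : B * Q = 0 := by
      have : B * Q = (1 - U * U') * (U * M) * M := by
        simp only [B, Q]; rw [mul_assoc, ← mul_assoc M U M, ← hUM]; simp only [mul_assoc]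
      rw [this, ← mul_assoc, sub_mul, one_mul, hp', sub_self]; simp
    have a7 : Q' * B' = 0 := by
      have : Q' * B' = M * (M * U') * (1 - U * U') := by
        simp only [B', Q']; rw [mul_assoc M U', ← mul_assoc U' M, ← hUM', ← mul_assoc]
      rw [this, ← mul_assoc, mul_assoc (M * M), mul_sub, mul_one, ← mul_assoc, hp, sub_self]; simp
    have ap : ∀ {X Y Z : K →L[ℂ] K}, X * Y = Z → ∀ x, X (Y x) = Z x := by
      intro X Y Z h x; rw [← h]; rfl
    have b4 : ∀ x, B' (B x) + Q (Q' x) = M (M x) := fun x => by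
      have := congrArg (fun T => T x) a4; simpa using this
    have b5 : ∀ x, Q (Q' x) + B (B' x) = M (M x) := fun x => by
      have := congrArg (fun T => T x) a5; simpa using this
    have e1 : ∀ x : WithLp 2 (K × K), Na (N x) =
        WithLp.toLp 2 (M (M x.fst), M (M x.snd)) := by
      intro x
      have := ap a1 x.fst
      simp [N, Na, E, N0, N1, ap a1, ap a2, ap a3, b4]
    have e2 : ∀ x : WithLp 2 (K × K), N (Na x) =
        WithLp.toLp 2 (M (M x.fst), M (M x.snd)) := by
      intro x
      have h := b5 x.fst
      simp [N, Na, E, N0, N1, ap a1, ap a6, ap a7, h]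
    change Na * N = N * Na
    ext1 x
    exact (e1 x).trans (e2 x).symm
  · intro x
    simp [N, E, N0, Q]

open MeasureTheory in
/-- A consistent family of representing measures for a weighted shift. -/
structure MSys {V : Type u} (p : V → V) (lam : V → ℂ) (R : NNReal)
    (μ : V → Measure NNReal) : Prop where
  prob : ∀ v, IsProbabilityMeasure (μ v)
  supp : ∀ v, μ v (Set.Ioi R) = 0
  rel : ∀ v (s : Set NNReal), MeasurableSet s →
    ∫⁻ x in s, (x : ℝ≥0∞) ∂(μ v) = ∑' u, if p u = v then ‖lam u‖ₑ ^ 2 * μ u s else 0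

open MeasureTheory in
lemma MSys.lint {V : Type u} {p : V → V} {lam : V → ℂ} {R : NNReal}
    {μ : V → Measure NNReal} (h : MSys p lam R μ) (v : V) (g : NNReal → ℝ≥0∞)
    (hg : Measurable g) :
    ∫⁻ x, (x : ℝ≥0∞) * g x ∂(μ v) =
      ∑' u, if p u = v then ‖lam u‖ₑ ^ 2 * ∫⁻ x, g x ∂(μ u) else 0 := by
  have hm : (μ v).withDensity (fun x => (x : ℝ≥0∞)) =
      Measure.sum (fun u => (if p u = v then ‖lam u‖ₑ ^ 2 else 0) • μ u) := by
    ext s hs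
    rw [withDensity_apply _ hs, h.rel v s hs, Measure.sum_apply _ hs]
    congr 1; ext u
    by_cases hu : p u = v <;> simp [hu]
  have h1 := lintegral_withDensity_eq_lintegral_mul (μ v)
    (f := fun x : NNReal => (x : ℝ≥0∞)) measurable_coe_nnreal_ennreal hg
  rw [hm, lintegral_sum_measure] at h1
  simp only [Pi.mul_apply] at h1
  rw [← h1]
  congr 1; ext u
  rw [lintegral_smul_measure]
  by_cases hu : p u = v <;> simp [hu]

lemma hs_enorm {V : Type u} (f : Hs V) : ‖f‖ₑ ^ 2 = ∑' v, ‖(f : ∀ _ : V, ℂ) v‖ₑ ^ 2 := by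
  have h0 : (0:ℝ) < (2 : ℝ≥0∞).toReal := by simp
  have h1 := lp.hasSum_norm h0 f
  simp only [ENNReal.toReal_ofNat, Real.rpow_ofNat] at h1
  have h2 := ENNReal.ofReal_tsum_of_nonneg (fun v => by positivity) h1.summable
  rw [h1.tsum_eq] at h2
  rw [← ofReal_norm, ← ENNReal.ofReal_pow (norm_nonneg _), h2]
  congr 1; ext v
  rw [ENNReal.ofReal_pow (norm_nonneg _), ofReal_norm]

lemma memHs_of_tsum {V : Type u} (f : V → ℂ) (h : ∑' v, ‖f v‖ₑ ^ 2 ≠ ∞) :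
    Memℓp f 2 := by
  refine memℓp_gen ?_
  have := ENNReal.summable_toReal h
  refine this.congr fun v => ?_
  simp [ENNReal.toReal_pow]

open MeasureTheory in
/-- the ambient measure on `V × [0,∞)` -/
def bigMeasure {V : Type u} [MeasurableSpace V] (μ : V → Measure NNReal) :
    Measure (V × NNReal) :=
  Measure.sum fun v => (μ v).map fun x => (v, x)

open MeasureTheory in
lemma lint_big {V : Type u} [MeasurableSpace V] (μ : V → Measure NNReal)
    (g : V × NNReal → ℝ≥0∞) (hg : Measurable g) :
    ∫⁻ z, g z ∂(bigMeasure μ) = ∑' v, ∫⁻ x, g (v, x) ∂(μ v) := by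
  rw [bigMeasure, lintegral_sum_measure]
  congr 1; ext v
  rw [lintegral_map hg measurable_prodMk_left]

open MeasureTheory in
lemma lint_key {V : Type u} [MeasurableSpace V] [DiscreteMeasurableSpace V]
    {p : V → V} {lam : V → ℂ} {R : NNReal}
    {μ : V → Measure NNReal} (h : MSys p lam R μ)
    (g : V × NNReal → ℝ≥0∞) (hg : Measurable g) :
    ∫⁻ z, ‖lam z.1‖ₑ ^ 2 * g (p z.1, z.2) ∂(bigMeasure μ) =
      ∫⁻ z, (z.2 : ℝ≥0∞) * g z ∂(bigMeasure μ) := by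
  have hp : Measurable p := Measurable.of_discrete
  have hlam : Measurable lam := Measurable.of_discrete
  rw [lint_big _ _ (by fun_prop), lint_big _ _ (by fun_prop)]
  have e1 : ∀ v, ∫⁻ x, (x : ℝ≥0∞) * g (v, x) ∂(μ v) = _ := fun v =>
    h.lint v (fun x => g (v, x)) (by fun_prop)
  simp only [e1]
  rw [ENNReal.tsum_comm]
  congr 1; ext u
  rw [tsum_ite_eq' (p u) (fun v => ‖lam u‖ₑ ^ 2 * ∫⁻ x, g (v, x) ∂(μ u))]
  rw [lintegral_const_mul _ (by fun_prop)]


open MeasureTheory in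
lemma lint_bound {V : Type u} [MeasurableSpace V]
    {p : V → V} {lam : V → ℂ} {R : NNReal}
    {μ : V → Measure NNReal} (h : MSys p lam R μ)
    (g : V × NNReal → ℝ≥0∞) (hg : Measurable g) :
    ∫⁻ z, (z.2 : ℝ≥0∞) * g z ∂(bigMeasure μ) ≤ R * ∫⁻ z, g z ∂(bigMeasure μ) := by
  rw [lint_big _ _ (by fun_prop), lint_big _ _ hg, ← ENNReal.tsum_mul_left]
  refine ENNReal.tsum_le_tsum fun v => ?_
  rw [← lintegral_const_mul _ (by fun_prop)]
  refine lintegral_mono_ae ?_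
  have : ∀ᵐ x ∂(μ v), x ≤ R := by
    rw [ae_iff]; simpa [Set.Ioi] using h.supp v
  filter_upwards [this] with x hx
  gcongr

open MeasureTheory in
lemma lp2_enorm {Z : Type u} [MeasurableSpace Z] {ν : Measure Z} (f : Lp ℂ 2 ν) :
    ‖f‖ₑ ^ 2 = ∫⁻ z, ‖f z‖ₑ ^ 2 ∂ν := by
  rw [Lp.enorm_def, eLpNorm_eq_lintegral_rpow_enorm_toReal (by simp) (by simp)]
  rw [← ENNReal.rpow_natCast, ← ENNReal.rpow_mul]; simp

lemma sqrt_facts (x : NNReal) :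
    (x : ℝ≥0∞) * ‖(((NNReal.sqrt x)⁻¹ : NNReal) : ℂ)‖ₑ ^ 2 =
      ‖(if x = 0 then 0 else 1 : ℂ)‖ₑ ^ 2 ∧
    ‖((NNReal.sqrt x : NNReal) : ℂ)‖ₑ ^ 2 = (x : ℝ≥0∞) := by
  have e : ∀ y : NNReal, ‖((y : NNReal) : ℂ)‖ₑ = (y : ℝ≥0∞) := by
    intro y
    rw [← ofReal_norm]; simp
  rw [e, e]
  constructor
  · by_cases hx : x = 0
    · simp [hx]
    · simp only [hx, if_false]
      norm_cast
      rw [inv_pow, NNReal.sq_sqrt, mul_inv_cancel₀ hx]; simp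
  · norm_cast; rw [NNReal.sq_sqrt]

lemma norm_eq_of_enorm_sq {E F : Type*} [NormedAddCommGroup E] [NormedAddCommGroup F]
    {x : E} {y : F} (h1 : ‖x‖ₑ ^ 2 = ‖y‖ₑ ^ 2) : ‖x‖ = ‖y‖ := by
  simp only [enorm_eq_nnnorm] at h1
  have h2 : ‖x‖₊ ^ 2 = ‖y‖₊ ^ 2 := by exact_mod_cast h1
  have h3 : ‖x‖ ^ 2 = ‖y‖ ^ 2 := congrArg NNReal.toReal h2
  exact (pow_left_inj₀ (norm_nonneg _) (norm_nonneg _) two_ne_zero).1 h3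

open MeasureTheory in
/-- A consistent system of measures yields a bounded subnormal weighted shift. -/
theorem MSys.exists_subnormal {V : Type u} {p : V → V} {lam : V → ℂ} {R : NNReal}
    {μ : V → Measure NNReal} (h : MSys p lam R μ) :
    ∃ S : Hs V →L[ℂ] Hs V, IsWeightedShift p lam S ∧ ‖S‖ ≤ NNReal.sqrt R ∧ Subnormal S := by
  let _ : MeasurableSpace V := ⊤
  have _ : DiscreteMeasurableSpace V := ⟨fun _ => trivial⟩
  have hp : Measurable p := Measurable.of_discrete
  have hlam : Measurable lam := Measurable.of_discrete
  have hprob := h.prob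
  set ν := bigMeasure μ with hν
  -- the operator S
  have hf0 : ∀ f : V → ℂ, ∫⁻ z, ‖f z.1‖ₑ ^ 2 ∂ν = ∑' v, ‖f v‖ₑ ^ 2 := by
    intro f
    have hf : Measurable f := Measurable.of_discrete
    rw [hν, lint_big _ _ (by fun_prop)]
    simp
  have hS0 : ∀ f : V → ℂ, ∑' v, ‖lam v * f (p v)‖ₑ ^ 2 ≤ R * ∑' v, ‖f v‖ₑ ^ 2 := by
    intro f
    have hf : Measurable f := Measurable.of_discrete
    have h1 := lint_key h (fun z => ‖f z.1‖ₑ ^ 2) (by fun_prop)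
    have h2 := lint_bound h (fun z => ‖f z.1‖ₑ ^ 2) (by fun_prop)
    rw [← h1, ← hν, hf0] at h2
    refine le_trans (le_of_eq ?_) h2
    rw [← hf0 (fun v => lam v * f (p v))]
    simp only [enorm_mul, mul_pow]
  have hSm : ∀ f : Hs V, Memℓp (fun v => lam v * (f : ∀ _ : V, ℂ) (p v)) 2 := by
    intro f
    refine memHs_of_tsum _ (ne_top_of_le_ne_top ?_ (hS0 _))
    rw [← hs_enorm]
    exact ENNReal.mul_ne_top (by simp) (by simp)
  let S0 : Hs V →ₗ[ℂ] Hs V :=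
    { toFun := fun f => ⟨_, hSm f⟩
      map_add' := by
        intro f g; ext v; simp [mul_add]; rfl
      map_smul' := by
        intro c f; ext v; simp [mul_left_comm] }
  have hSb : ∀ f, ‖S0 f‖ ≤ (NNReal.sqrt R : ℝ) * ‖f‖ := by
    intro f
    have h1 : ‖S0 f‖ₑ ^ 2 ≤ R * ‖f‖ₑ ^ 2 := by
      rw [hs_enorm, hs_enorm]; exact hS0 _
    have h2 : ‖S0 f‖₊ ^ 2 ≤ R * ‖f‖₊ ^ 2 := by
      simp only [enorm_eq_nnnorm] at h1
      exact_mod_cast h1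
    have h3 : ‖S0 f‖₊ ≤ NNReal.sqrt R * ‖f‖₊ := by
      rw [← NNReal.sqrt_sq ‖f‖₊, ← NNReal.sqrt_mul]
      exact NNReal.le_sqrt_iff_sq_le.2 h2
    exact h3
  let S := S0.mkContinuous _ hSb
  have hSv : IsWeightedShift p lam S := fun f v => rfl
  refine ⟨S, hSv, LinearMap.mkContinuous_norm_le _ (by positivity) _, ?_⟩
  -- the three operators
  let π : V × NNReal → V × NNReal := fun z => (p z.1, z.2)
  have hπ : Measurable π := by fun_prop
  let wU : V × NNReal → ℂ := fun z => lam z.1 * (((NNReal.sqrt z.2)⁻¹ : NNReal) : ℂ)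
  let wP : V × NNReal → ℂ := fun z => if z.2 = 0 then 0 else 1
  let wM : V × NNReal → ℂ := fun z => ((NNReal.sqrt z.2 : NNReal) : ℂ)
  have hsq : Measurable fun x : NNReal => NNReal.sqrt x := NNReal.continuous_sqrt.measurable
  have hwU : Measurable wU := by
    refine (hlam.comp measurable_fst).mul ?_
    exact Complex.measurable_ofReal.comp (measurable_coe_nnreal_real.comp
      ((hsq.comp measurable_snd).inv))
  have hwP : Measurable wP :=
    Measurable.ite (measurable_snd (measurableSet_singleton 0)) measurable_const measurable_const
  have hwM : Measurable wM :=
    Complex.measurable_ofReal.comp (measurable_coe_nnreal_real.comp (hsq.comp measurable_snd))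
  have hkU : ∀ g : V × NNReal → ℝ≥0∞, Measurable g →
      ∫⁻ z, ‖wU z‖ₑ ^ 2 * g (π z) ∂ν = ∫⁻ z, ‖wP z‖ₑ ^ 2 * g z ∂ν := by
    intro g hg
    have hm : Measurable fun z : V × NNReal => (((NNReal.sqrt z.2)⁻¹ : NNReal) : ℂ) :=
      Complex.measurable_ofReal.comp (measurable_coe_nnreal_real.comp
        ((hsq.comp measurable_snd).inv))
    have h1 := lint_key h (fun z => ‖(((NNReal.sqrt z.2)⁻¹ : NNReal) : ℂ)‖ₑ ^ 2 * g z)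
      ((hm.enorm.pow_const 2).mul hg)
    simp only [← mul_assoc, sqrt_facts] at h1
    rw [← hν] at h1
    rw [← h1]
    simp only [wU, enorm_mul, mul_pow, π]
  have hP1 : ∀ z, ‖wP z‖ₑ ^ 2 ≤ 1 := by
    intro z; simp only [wP]; split_ifs <;> simp
  have hbP : ∀ g : V × NNReal → ℝ≥0∞, Measurable g →
      ∫⁻ z, ‖wP z‖ₑ ^ 2 * g z ∂ν ≤ ((1 : NNReal) : ℝ≥0∞) ^ 2 * ∫⁻ z, g z ∂ν := by
    intro g hg
    simp only [ENNReal.coe_one, one_pow, one_mul]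
    exact lintegral_mono fun z => mul_le_of_le_one_left' (hP1 z)
  have hbM : ∀ g : V × NNReal → ℝ≥0∞, Measurable g →
      ∫⁻ z, ‖wM z‖ₑ ^ 2 * g z ∂ν ≤ ((NNReal.sqrt R : NNReal) : ℝ≥0∞) ^ 2 * ∫⁻ z, g z ∂ν := by
    intro g hg
    have h2 := lint_bound h g hg
    have : ((NNReal.sqrt R : NNReal) : ℝ≥0∞) ^ 2 = R := by
      norm_cast; rw [NNReal.sq_sqrt]
    rw [this]
    simpa only [wM, sqrt_facts] using h2
  obtain ⟨cU, U, -, hU⟩ := exists_wco ν π hπ wU hwU 1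
    (fun g hg => (hkU g hg).trans_le (hbP g hg))
  obtain ⟨cP, P, -, hP⟩ := exists_wco ν id measurable_id wP hwP 1 hbP
  obtain ⟨cM, M, -, hM⟩ := exists_wco ν id measurable_id wM hwM _ hbM
  simp only [id] at cP hP cM hM
  have conjM : ∀ z, (starRingEnd ℂ) (wM z) = wM z := fun z => Complex.conj_ofReal _
  have conjP : ∀ z, (starRingEnd ℂ) (wP z) = wP z := by
    intro z; simp only [wP]; split_ifs <;> simp
  have adjM : ContinuousLinearMap.adjoint M = M := by
    symm
    rw [ContinuousLinearMap.eq_adjoint_iff]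
    intro f g
    rw [L2.inner_def, L2.inner_def]
    refine integral_congr_ae ?_
    filter_upwards [hM f, hM g] with z h1 h2
    rw [h1, h2]; simp [conjM]; ring
  have inP : ∀ f, inner ℂ (P f) f = inner ℂ (P f) (P f) := by
    intro f
    rw [L2.inner_def, L2.inner_def]
    refine integral_congr_ae ?_
    filter_upwards [hP f] with z h1
    rw [h1]; simp only [wP]; split_ifs <;> simp
  have nUP : ∀ f, ‖U f‖ = ‖P f‖ := by
    intro f
    have hfm : Measurable (f : V × NNReal → ℂ) := (Lp.stronglyMeasurable f).measurable
    have h1 : ‖U f‖ₑ ^ 2 = ‖P f‖ₑ ^ 2 := by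
      rw [lp2_enorm, lp2_enorm]
      have a1 : ∫⁻ z, ‖U f z‖ₑ ^ 2 ∂ν = ∫⁻ z, ‖wU z‖ₑ ^ 2 * ‖f (π z)‖ₑ ^ 2 ∂ν := by
        refine lintegral_congr_ae ?_
        filter_upwards [hU f] with z hz
        rw [hz, enorm_mul, mul_pow]
      have a2 : ∫⁻ z, ‖P f z‖ₑ ^ 2 ∂ν = ∫⁻ z, ‖wP z‖ₑ ^ 2 * ‖f z‖ₑ ^ 2 ∂ν := by
        refine lintegral_congr_ae ?_
        filter_upwards [hP f] with z hz
        rw [hz, enorm_mul, mul_pow]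
      rw [a1, a2]
      exact hkU (fun z => ‖f z‖ₑ ^ 2) (hfm.enorm.pow_const 2)
    exact norm_eq_of_enorm_sq h1
  have hUU : ContinuousLinearMap.adjoint U * U = P := by
    have : ((ContinuousLinearMap.adjoint U * U : Lp ℂ 2 ν →L[ℂ] Lp ℂ 2 ν) :
        Lp ℂ 2 ν →ₗ[ℂ] Lp ℂ 2 ν) = (P : Lp ℂ 2 ν →ₗ[ℂ] Lp ℂ 2 ν) := by
      rw [← ext_inner_map]
      intro f
      simp only [ContinuousLinearMap.coe_coe, mul_apply_eq_comp]
      rw [ContinuousLinearMap.adjoint_inner_left, inP, inner_self_eq_norm_sq_to_K,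
        inner_self_eq_norm_sq_to_K, nUP]
    exact ContinuousLinearMap.coe_injective this
  have hUP : U * P = U := by
    ext1 f
    refine Lp.ext ?_
    filter_upwards [hU (P f), hU f, cU _ _ (hP f)] with z h1 h2 h3
    rw [mul_apply_eq_comp, h1, h2, h3]
    simp only [wU, wP, π]
    by_cases hz : z.2 = 0 <;> simp [hz]
  have hPM : P * M = M := by
    ext1 f
    refine Lp.ext ?_
    filter_upwards [hP (M f), hM f] with z h1 h2
    rw [mul_apply_eq_comp, h1, h2]
    simp only [wP, wM]
    by_cases hz : z.2 = 0 <;> simp [hz]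
  have hUM : U * M = M * U := by
    ext1 f
    refine Lp.ext ?_
    filter_upwards [hU (M f), hU f, cU _ _ (hM f), hM (U f)] with z h1 h2 h3 h4
    rw [mul_apply_eq_comp, mul_apply_eq_comp, h1, h4, h2, h3]
    simp only [wU, wM, π]
    ring
  obtain ⟨N, hN, hNx⟩ := normal_dilation U M P adjM hUU hUP hPM hUM
  -- the embedding
  have hJm : ∀ f : Hs V, MemLp (fun z : V × NNReal => (f : ∀ _ : V, ℂ) z.1) 2 ν := by
    intro f
    have hf : Measurable (f : ∀ _ : V, ℂ) := Measurable.of_discrete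
    refine ⟨(hf.comp measurable_fst).aestronglyMeasurable, ?_⟩
    rw [eLpNorm_lt_top_iff_lintegral_rpow_enorm_lt_top (by simp) (by simp)]
    have := hf0 (f : ∀ _ : V, ℂ)
    rw [← hs_enorm] at this
    simp only [ENNReal.toReal_ofNat, ENNReal.rpow_ofNat, this]
    exact ENNReal.pow_lt_top (by simp)
  have hJn : ∀ f : Hs V, ‖(hJm f).toLp _‖ = ‖f‖ := by
    intro f
    have h1 : ‖(hJm f).toLp _‖ₑ ^ 2 = ‖f‖ₑ ^ 2 := by
      rw [lp2_enorm, hs_enorm, ← hf0]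
      refine lintegral_congr_ae ?_
      filter_upwards [(hJm f).coeFn_toLp] with z hz
      rw [hz]
    exact norm_eq_of_enorm_sq h1
  let J : Hs V →ₗᵢ[ℂ] WithLp 2 (Lp ℂ 2 ν × Lp ℂ 2 ν) :=
    { toFun := fun f => WithLp.toLp 2 ((hJm f).toLp _, 0)
      map_add' := by
        intro f g
        rw [← WithLp.toLp_add, Prod.mk_add_mk, ← MemLp.toLp_add, add_zero]
        rfl
      map_smul' := by
        intro c f
        rw [RingHom.id_apply, ← WithLp.toLp_smul, Prod.smul_mk, ← MemLp.toLp_const_smul, smul_zero]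
        rfl
      norm_map' := by
        intro f
        change ‖WithLp.toLp 2 ((hJm f).toLp _, (0 : Lp ℂ 2 ν))‖ = ‖f‖
        rw [WithLp.prod_norm_eq_of_L2]
        change Real.sqrt (‖(hJm f).toLp _‖ ^ 2 + ‖(0 : Lp ℂ 2 ν)‖ ^ 2) = ‖f‖
        rw [hJn, norm_zero, zero_pow two_ne_zero, add_zero, Real.sqrt_sq (norm_nonneg _)] }
  refine ⟨WithLp 2 (Lp ℂ 2 ν × Lp ℂ 2 ν), inferInstance, inferInstance, inferInstance, J, N, hN, ?_⟩
  intro f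
  change N (WithLp.toLp 2 ((hJm f).toLp _, 0)) = WithLp.toLp 2 ((hJm (S f)).toLp _, 0)
  rw [hNx]
  congr 2
  change (U * M) _ = _
  rw [hUM]
  have h5' : ∀ᵐ z ∂ν, lam z.1 * (((NNReal.sqrt z.2)⁻¹ : NNReal) : ℂ) *
      ((NNReal.sqrt z.2 : NNReal) : ℂ) = lam z.1 := by
    -- `lam = 0` almost everywhere on `x = 0`
    have hm : Measurable fun z : V × NNReal => Set.indicator {z : V × NNReal | z.2 = 0}
        (1 : V × NNReal → ℝ≥0∞) z :=
      measurable_one.indicator (measurable_snd (measurableSet_singleton 0))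
    have h1 := lint_key h _ hm
    have h2 : ∫⁻ z, (z.2 : ℝ≥0∞) * Set.indicator {z : V × NNReal | z.2 = 0} 1 z
        ∂(bigMeasure μ) = 0 := by
      rw [lintegral_eq_zero_iff (by fun_prop)]
      refine Filter.Eventually.of_forall fun z => ?_
      by_cases hz : z.2 = 0 <;> simp [Set.indicator, hz]
    rw [h2, lintegral_eq_zero_iff (by fun_prop)] at h1
    filter_upwards [h1] with z hz
    by_cases hz0 : z.2 = 0
    · have : lam z.1 = 0 := by simpa [Set.indicator, hz0] using hz
      simp [this]
    · rw [mul_assoc, ← Complex.ofReal_mul, ← NNReal.coe_mul, inv_mul_cancel₀ (by simpa using hz0)]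
      simp
  refine Lp.ext ?_
  filter_upwards [hM (U ((hJm f).toLp _)), hU ((hJm f).toLp _),
    cU _ _ (hJm f).coeFn_toLp, (hJm (S f)).coeFn_toLp,
    h5'] with z h1 h2 h3 h4 h5
  rw [mul_apply_eq_comp, h1, h2, h3, h4, hSv f z.1]
  simp only [wU, wM, π]
  rw [← mul_assoc, mul_comm (((NNReal.sqrt z.2 : NNReal) : ℂ)), h5]

open MeasureTheory in
/-- spectral measures: moments of `N* N` for a normal operator `N` -/
lemma exists_moment_measure {K : Type u} [NormedAddCommGroup K] [InnerProductSpace ℂ K]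
    [CompleteSpace K] (N : K →L[ℂ] K) (hN : IsStarNormal N) (x : K) :
    ∃ μ : Measure NNReal, ∀ n : ℕ, ∫⁻ t, (t : ℝ≥0∞) ^ n ∂μ = ‖(N ^ n) x‖ₑ ^ 2 := by
  set A : K →L[ℂ] K := star N * N with hA
  have hA0 : 0 ≤ A := star_mul_self_nonneg N
  let X := spectrum NNReal A
  have hpos : ∀ f : C(X, NNReal), 0 ≤ RCLike.re (inner ℂ (cfcHom hA0 f x) x) := by
    intro f
    have h1 : (0 : K →L[ℂ] K) ≤ cfcHom hA0 f := cfcHom_predicate hA0 f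
    rw [ContinuousLinearMap.nonneg_iff_isPositive] at h1
    exact h1.re_inner_nonneg_left x
  let Λ : CompactlySupportedContinuousMap X NNReal →ₗ[NNReal] NNReal :=
    { toFun := fun f => ⟨RCLike.re (inner ℂ (cfcHom hA0 f.toContinuousMap x) x), hpos _⟩
      map_add' := by
        intro f g
        have : (f + g).toContinuousMap = f.toContinuousMap + g.toContinuousMap := rfl
        ext
        simp only [this, map_add, ContinuousLinearMap.add_apply, inner_add_left, NNReal.coe_add,
          NNReal.coe_mk]
        simp
        rfl
      map_smul' := by
        intro c f
        have h1 : (c • f).toContinuousMap = c • f.toContinuousMap := rfl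
        have h2 : (cfcHom hA0 (c • f.toContinuousMap) : K →L[ℂ] K) =
            ((c : ℝ) : ℂ) • cfcHom hA0 f.toContinuousMap := by
          rw [map_smul]; rfl
        ext
        simp only [h1, h2]
        simp [inner_smul_left]
        rfl }
  refine ⟨(NNRealRMK.rieszMeasure Λ).map Subtype.val, fun n => ?_⟩
  rw [lintegral_map (by fun_prop) measurable_subtype_coe]
  let idX : C(X, NNReal) := (ContinuousMap.id NNReal).restrict X
  have h1 := NNRealRMK.lintegral_rieszMeasure Λ
    (CompactlySupportedContinuousMap.continuousMapEquiv (idX ^ n))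
  have h2 : ∀ y : X, ((CompactlySupportedContinuousMap.continuousMapEquiv (idX ^ n) y : NNReal) :
      ℝ≥0∞) = ((y : NNReal) : ℝ≥0∞) ^ n := by
    intro y; simp [idX]
  simp only [h2] at h1
  rw [h1]
  have h3 : cfcHom hA0 (idX ^ n) = (star N) ^ n * N ^ n := by
    rw [map_pow, cfcHom_id, hA, hN.star_comm_self.mul_pow]
  have h4 : ((Λ (CompactlySupportedContinuousMap.continuousMapEquiv (idX ^ n)) : NNReal) : ℝ) =
      ‖(N ^ n) x‖ ^ 2 := by
    change RCLike.re (inner ℂ (cfcHom hA0 (idX ^ n) x) x) = _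
    rw [h3, ← star_pow, mul_apply_eq_comp, ContinuousLinearMap.star_eq_adjoint,
      ContinuousLinearMap.adjoint_inner_left, inner_self_eq_norm_sq]
  have h5 : Λ (CompactlySupportedContinuousMap.continuousMapEquiv (idX ^ n)) = ‖(N ^ n) x‖₊ ^ 2 := by
    ext; rw [h4]; simp
  rw [h5, enorm_eq_nnnorm]; simp

open MeasureTheory in
lemma supp_of_moments (μ : Measure NNReal) (R : NNReal)
    (h : ∀ n : ℕ, ∫⁻ t, (t : ℝ≥0∞) ^ n ∂μ ≤ (R : ℝ≥0∞) ^ n) : μ (Set.Ioi R) = 0 := by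
  have h1 : ∀ r : NNReal, R < r → μ (Set.Ici r) = 0 := by
    intro r hr
    have hr0 : 0 < r := lt_of_le_of_lt (zero_le) hr
    have h2 : ∀ n : ℕ, μ (Set.Ici r) ≤ (((R / r) ^ n : NNReal) : ℝ≥0∞) := by
      intro n
      have h3 := mul_meas_ge_le_lintegral₀ (μ := μ) (f := fun t : NNReal => (t : ℝ≥0∞) ^ n)
        (by fun_prop) ((r : ℝ≥0∞) ^ n)
      have h4 : μ (Set.Ici r) ≤ μ {t : NNReal | (r : ℝ≥0∞) ^ n ≤ (t : ℝ≥0∞) ^ n} := by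
        refine measure_mono fun t ht => ?_
        have : r ≤ t := ht
        simp only [Set.mem_setOf_eq]
        gcongr
      have h5 : (r : ℝ≥0∞) ^ n * μ (Set.Ici r) ≤ (R : ℝ≥0∞) ^ n :=
        (mul_le_mul_right h4 _).trans (h3.trans (h n))
      rw [div_pow, ENNReal.coe_div (by positivity), ENNReal.coe_pow, ENNReal.coe_pow]
      rw [ENNReal.le_div_iff_mul_le (by left; positivity) (by left; simp), mul_comm]
      exact h5
    have h6 : Filter.Tendsto (fun n : ℕ => (((R / r) ^ n : NNReal) : ℝ≥0∞)) Filter.atTop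
        (nhds ((0 : NNReal) : ℝ≥0∞)) :=
      ENNReal.tendsto_coe.2 (tendsto_pow_atTop_nhds_zero_of_lt_one (zero_le)
        ((div_lt_one hr0).2 hr))
    exact nonpos_iff_eq_zero.1 (ge_of_tendsto' h6 h2)
  have h2 : Set.Ioi R ⊆ ⋃ n : ℕ, Set.Ici (R + 1 / ((n : NNReal) + 1)) := by
    intro t ht
    have ht' : R < t := ht
    obtain ⟨n, hn⟩ := exists_nat_one_div_lt (tsub_pos_of_lt ht')
    refine Set.mem_iUnion.2 ⟨n, ?_⟩
    have := add_le_add_right hn.le R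
    rw [add_tsub_cancel_of_le ht'.le] at this
    exact this
  refine measure_mono_null h2 (measure_iUnion_null fun n => h1 _ ?_)
  exact lt_add_of_pos_right _ (by positivity)

open MeasureTheory in
/-- A compactly supported finite measure is determined by its moments. -/
lemma meas_ext (μ ν : Measure NNReal) [IsFiniteMeasure μ] [IsFiniteMeasure ν] (R : NNReal)
    (hμ : μ (Set.Ioi R) = 0) (hν : ν (Set.Ioi R) = 0)
    (hm : ∀ n : ℕ, ∫⁻ t, (t : ℝ≥0∞) ^ n ∂μ = ∫⁻ t, (t : ℝ≥0∞) ^ n ∂ν) : μ = ν := by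
  let E := Set.Iic R
  have hE : MeasurableSet E := measurableSet_Iic
  have hemb : MeasurableEmbedding (Subtype.val : E → NNReal) := MeasurableEmbedding.subtype_coe hE
  have hpol : PolishSpace E := isClosed_Iic.polishSpace
  have hcE : CompactSpace E := by
    rw [← isCompact_iff_compactSpace]
    have : E = Set.Icc 0 R := by ext x; simp [E]
    rw [this]; exact isCompact_Icc
  have hmap : ∀ κ : Measure NNReal, κ (Set.Ioi R) = 0 →
      (κ.comap (Subtype.val : E → NNReal)).map Subtype.val = κ := by
    intro κ hκ
    rw [hemb.map_comap, Subtype.range_coe, Measure.restrict_eq_self_of_ae_mem]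
    rw [ae_iff]
    have : {a | a ∉ E} = Set.Ioi R := by ext x; simp [E]
    rw [this, hκ]
  have hfin : ∀ κ : Measure NNReal, IsFiniteMeasure κ →
      IsFiniteMeasure (κ.comap (Subtype.val : E → NNReal)) := by
    intro κ hκ
    refine ⟨?_⟩
    rw [hemb.comap_apply]; exact measure_lt_top _ _
  have hf1 := hfin μ inferInstance
  have hf2 := hfin ν inferInstance
  suffices hc : μ.comap (Subtype.val : E → NNReal) = ν.comap (Subtype.val : E → NNReal) by
    rw [← hmap μ hμ, ← hmap ν hν, hc]
  let A : StarSubalgebra ℝ (BoundedContinuousFunction E ℝ) :=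
    { carrier := {g | ∃ P : Polynomial ℝ, ∀ x, g x = P.eval ((x : NNReal) : ℝ)}
      mul_mem' := by
        rintro a b ⟨P, hP⟩ ⟨Q, hQ⟩
        exact ⟨P * Q, fun x => by simp [hP, hQ]⟩
      add_mem' := by
        rintro a b ⟨P, hP⟩ ⟨Q, hQ⟩
        exact ⟨P + Q, fun x => by simp [hP, hQ]⟩
      algebraMap_mem' := by
        intro r
        exact ⟨Polynomial.C r, fun x => by simp⟩
      star_mem' := by
        rintro a ⟨P, hP⟩
        exact ⟨P, fun x => by simp [hP]⟩ }
  refine ext_of_forall_mem_subalgebra_integral_eq_of_polish (A := A) ?_ ?_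
  · intro x y hxy
    let f : BoundedContinuousFunction E ℝ :=
      BoundedContinuousFunction.mkOfCompact ⟨fun x => ((x : NNReal) : ℝ), by fun_prop⟩
    refine ⟨f, ⟨BoundedContinuousFunction.toContinuousMapStarₐ ℝ f, ?_, rfl⟩, ?_⟩
    · exact ⟨f, ⟨Polynomial.X, fun x => by simp [f]⟩, rfl⟩
    · intro h
      apply hxy
      have : ((x : NNReal) : ℝ) = ((y : NNReal) : ℝ) := h
      exact Subtype.ext (NNReal.coe_injective this)
  · rintro g ⟨P, hP⟩
    have hintg : ∀ κ : Measure E, IsFiniteMeasure κ → ∀ n : ℕ,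
        Integrable (fun x : E => (((x : NNReal) : ℝ)) ^ n) κ := by
      intro κ hκ n
      exact (BoundedContinuousFunction.mkOfCompact
        (⟨fun x : E => ((x : NNReal) : ℝ) ^ n, by fun_prop⟩ : C(E, ℝ))).integrable κ
    have hval : ∀ κ : Measure NNReal, κ (Set.Ioi R) = 0 → ∀ n : ℕ,
        ∫ x : E, (((x : NNReal) : ℝ)) ^ n ∂(κ.comap Subtype.val) =
          (∫⁻ t, (t : ℝ≥0∞) ^ n ∂κ).toReal := by
      intro κ hκ n
      rw [integral_eq_lintegral_of_nonneg_ae (Filter.Eventually.of_forall fun x => by positivity)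
        (Continuous.aestronglyMeasurable (by fun_prop))]
      congr 1
      nth_rewrite 2 [← hmap κ hκ]
      rw [hemb.lintegral_map]
      congr 1; ext x
      rw [ENNReal.ofReal_pow (by positivity), ENNReal.ofReal_coe_nnreal]
    simp only [hP, Polynomial.eval_eq_sum, Polynomial.sum]
    rw [integral_finsetSum _ (fun i _ => (hintg _ hf1 i).const_mul _),
      integral_finsetSum _ (fun i _ => (hintg _ hf2 i).const_mul _)]
    refine Finset.sum_congr rfl fun i _ => ?_
    rw [integral_const_mul, integral_const_mul, hval μ hμ, hval ν hν, hm]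

lemma ev_apply {V : Type u} (v w : V) :
    ((ev v : Hs V) : ∀ _ : V, ℂ) w = if w = v then 1 else 0 := by
  simp only [ev, lp.single_apply, Pi.single_apply]

lemma ws_pow {V : Type u} {p : V → V} {lam : V → ℂ} {S : Hs V →L[ℂ] Hs V}
    (hS : IsWeightedShift p lam S) (n : ℕ) :
    ∃ c : V → ℂ, ∀ (f : Hs V) (w : V),
      ((S ^ n) f : ∀ _ : V, ℂ) w = c w * (f : ∀ _ : V, ℂ) (p^[n] w) := by
  induction n with
  | zero => exact ⟨fun _ => 1, fun f w => by simp⟩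
  | succ n ih =>
    obtain ⟨c, hc⟩ := ih
    refine ⟨fun w => c w * lam (p^[n] w), fun f w => ?_⟩
    rw [pow_succ, mul_apply_eq_comp, hc, hS, Function.iterate_succ_apply', mul_assoc]

lemma ws_norm {V : Type u} {p : V → V} {lam : V → ℂ} {S : Hs V →L[ℂ] Hs V}
    (hS : IsWeightedShift p lam S) (n : ℕ) (f : Hs V) :
    ‖(S ^ n) f‖ₑ ^ 2 = ∑' u, ‖(f : ∀ _ : V, ℂ) u‖ₑ ^ 2 * ‖(S ^ n) (ev u)‖ₑ ^ 2 := by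
  obtain ⟨c, hc⟩ := ws_pow hS n
  have h1 : ∀ u, ‖(S ^ n) (ev u)‖ₑ ^ 2 = ∑' w, if p^[n] w = u then ‖c w‖ₑ ^ 2 else 0 := by
    intro u
    rw [hs_enorm]
    congr 1; ext w
    rw [hc, ev_apply]
    split_ifs <;> simp
  simp only [h1, ← ENNReal.tsum_mul_left]
  rw [ENNReal.tsum_comm, hs_enorm]
  congr 1; ext w
  have h2 : ∀ u, (‖(f : ∀ _ : V, ℂ) u‖ₑ ^ 2 * if p^[n] w = u then ‖c w‖ₑ ^ 2 else 0) =
      if p^[n] w = u then ‖(f : ∀ _ : V, ℂ) u‖ₑ ^ 2 * ‖c w‖ₑ ^ 2 else 0 := by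
    intro u; split_ifs <;> simp
  simp only [h2]
  rw [tsum_ite_eq' (p^[n] w) (fun u => ‖(f : ∀ _ : V, ℂ) u‖ₑ ^ 2 * ‖c w‖ₑ ^ 2), hc,
    enorm_mul, mul_pow, mul_comm]

lemma ws_moment_succ {V : Type u} {p : V → V} {lam : V → ℂ} {S : Hs V →L[ℂ] Hs V}
    (hS : IsWeightedShift p lam S) (n : ℕ) (v : V) :
    ‖(S ^ (n + 1)) (ev v)‖ₑ ^ 2 =
      ∑' u, if p u = v then ‖lam u‖ₑ ^ 2 * ‖(S ^ n) (ev u)‖ₑ ^ 2 else 0 := by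
  rw [pow_succ S n, mul_apply_eq_comp, ws_norm hS]
  congr 1; ext u
  rw [hS, ev_apply]
  split_ifs <;> simp

open MeasureTheory in
lemma lint_sum_smul {V : Type u} (c : V → ℝ≥0∞) (μ : V → Measure NNReal) (g : NNReal → ℝ≥0∞) :
    ∫⁻ x, g x ∂(Measure.sum fun u => c u • μ u) = ∑' u, c u * ∫⁻ x, g x ∂(μ u) := by
  rw [lintegral_sum_measure]
  congr 1; ext u
  rw [lintegral_smul_measure, smul_eq_mul]

open MeasureTheory in
lemma lint_le_supp (μ : Measure NNReal) (R : NNReal) (h : μ (Set.Ioi R) = 0) :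
    ∫⁻ x, (x : ℝ≥0∞) ∂μ ≤ R * μ Set.univ := by
  rw [← lintegral_const]
  refine lintegral_mono_ae ?_
  have : ∀ᵐ x ∂μ, x ∉ Set.Ioi R := measure_eq_zero_iff_ae_notMem.1 h
  filter_upwards [this] with x hx
  simpa using hx

lemma MSys.mono {V : Type u} {p : V → V} {lam : V → ℂ} {R R' : NNReal}
    {μ : V → MeasureTheory.Measure NNReal} (h : MSys p lam R μ) (hR : R ≤ R') :
    MSys p lam R' μ :=
  ⟨h.prob, fun v => MeasureTheory.measure_mono_null (Set.Ioi_subset_Ioi hR) (h.supp v), h.rel⟩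

open MeasureTheory in
lemma exists_msys {V : Type u} {p : V → V} {lam : V → ℂ} {S : Hs V →L[ℂ] Hs V}
    (hS : IsWeightedShift p lam S) (hsub : Subnormal S) :
    ∃ μ, MSys p lam (‖S‖₊ ^ 2) μ := by
  obtain ⟨K, i1, i2, i3, J, N, hN, hJ⟩ := hsub
  have hpow : ∀ (n : ℕ) x, (N ^ n) (J x) = J ((S ^ n) x) := by
    intro n
    induction n with
    | zero => intro x; simp
    | succ n ih => intro x; rw [pow_succ, mul_apply_eq_comp, hJ, ih, pow_succ, mul_apply_eq_comp]
  choose μ hμ using fun v => exists_moment_measure N hN (J (ev v))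
  have hmom : ∀ v n, ∫⁻ t, (t : ℝ≥0∞) ^ n ∂(μ v) = ‖(S ^ n) (ev v)‖ₑ ^ 2 := by
    intro v n
    rw [hμ, hpow]
    congr 1
    rw [← ofReal_norm, ← ofReal_norm, J.norm_map]
  have hev : ∀ v : V, ‖(ev v : Hs V)‖ₑ ^ 2 = 1 := by
    intro v
    rw [hs_enorm]
    have : ∀ w, ‖((ev v : Hs V) : ∀ _ : V, ℂ) w‖ₑ ^ 2 = if w = v then 1 else 0 := by
      intro w; rw [ev_apply]; split_ifs <;> simp
    simp only [this]
    exact tsum_ite_eq v _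
  have hprob : ∀ v, IsProbabilityMeasure (μ v) := by
    intro v
    refine ⟨?_⟩
    have := hmom v 0
    simpa [hev] using this
  have hbd : ∀ v n, ∫⁻ t, (t : ℝ≥0∞) ^ n ∂(μ v) ≤ ((‖S‖₊ ^ 2 : NNReal) : ℝ≥0∞) ^ n := by
    intro v n
    rw [hmom]
    have h1 : ‖(S ^ n) (ev v)‖ₑ ≤ ‖S‖ₑ ^ n * ‖(ev v : Hs V)‖ₑ := by
      simp only [enorm_eq_nnnorm]
      rw [← ENNReal.coe_pow, ← ENNReal.coe_mul, ENNReal.coe_le_coe]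
      refine ((S ^ n).le_opNNNorm _).trans ?_
      gcongr
      rcases Nat.eq_zero_or_pos n with rfl | hn
      · rw [pow_zero, pow_zero]; exact ContinuousLinearMap.norm_id_le (𝕜 := ℂ) (E := Hs V)
      · exact nnnorm_pow_le' S hn
    calc _ ≤ (‖S‖ₑ ^ n * ‖(ev v : Hs V)‖ₑ) ^ 2 := by gcongr
      _ = _ := by
        rw [mul_pow, hev, mul_one, enorm_eq_nnnorm, ← pow_mul, mul_comm, pow_mul]
        simp
  have hsupp : ∀ v, μ v (Set.Ioi (‖S‖₊ ^ 2)) = 0 := fun v => supp_of_moments _ _ (hbd v)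
  refine ⟨μ, hprob, hsupp, ?_⟩
  intro v s hs
  let c : V → ℝ≥0∞ := fun u => if p u = v then ‖lam u‖ₑ ^ 2 else 0
  have hm1 : ∀ n : ℕ, ∫⁻ t, (t : ℝ≥0∞) ^ n ∂((μ v).withDensity fun x => (x : ℝ≥0∞)) =
      ∫⁻ t, (t : ℝ≥0∞) ^ (n + 1) ∂(μ v) := by
    intro n
    rw [lintegral_withDensity_eq_lintegral_mul _ (by fun_prop) (by fun_prop)]
    simp only [Pi.mul_apply, pow_succ, mul_comm]
  have hm2 : ∀ n : ℕ, ∫⁻ t, (t : ℝ≥0∞) ^ n ∂(Measure.sum fun u => c u • μ u) =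
      ∫⁻ t, (t : ℝ≥0∞) ^ (n + 1) ∂(μ v) := by
    intro n
    rw [lint_sum_smul, hmom, ws_moment_succ hS]
    congr 1; ext u
    rw [hmom]
    simp only [c]; split_ifs <;> simp
  have hfin : ∀ n : ℕ, ∫⁻ t, (t : ℝ≥0∞) ^ n ∂(μ v) < ∞ := fun n =>
    (hbd v n).trans_lt (ENNReal.pow_lt_top (by simp))
  have f1 : IsFiniteMeasure ((μ v).withDensity fun x => (x : ℝ≥0∞)) := by
    refine ⟨?_⟩
    have := hm1 0
    simp only [pow_zero, lintegral_const, one_mul] at this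
    rw [this]; exact hfin _
  have f2 : IsFiniteMeasure (Measure.sum fun u => c u • μ u) := by
    refine ⟨?_⟩
    have := hm2 0
    simp only [pow_zero, lintegral_const, one_mul] at this
    rw [this]; exact hfin _
  have key : (μ v).withDensity (fun x => (x : ℝ≥0∞)) = Measure.sum fun u => c u • μ u := by
    refine meas_ext _ _ (‖S‖₊ ^ 2) ?_ ?_ fun n => (hm1 n).trans (hm2 n).symm
    · exact withDensity_absolutelyContinuous _ _ (hsupp v)
    · rw [Measure.sum_apply _ measurableSet_Ioi]
      simp [hsupp]
  rw [← withDensity_apply _ hs, key, Measure.sum_apply _ hs]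
  congr 1; ext u
  simp only [c, Measure.smul_apply, smul_eq_mul]; split_ifs <;> simp

open MeasureTheory in
lemma MSys.unique {V : Type u} {p : V → V} {lam : V → ℂ} {R R' : NNReal}
    {μ μ' : V → Measure NNReal} (h : MSys p lam R μ) (h' : MSys p lam R' μ') (v : V) :
    μ v = μ' v := by
  have hmom : ∀ n : ℕ, ∀ v, ∫⁻ t, (t : ℝ≥0∞) ^ n ∂(μ v) = ∫⁻ t, (t : ℝ≥0∞) ^ n ∂(μ' v) := by
    intro n
    induction n with
    | zero =>
      intro v
      have := h.prob v
      have := h'.prob v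
      simp
    | succ n ih =>
      intro v
      simp only [pow_succ']
      rw [h.lint v (fun x => (x : ℝ≥0∞) ^ n) (by fun_prop),
        h'.lint v (fun x => (x : ℝ≥0∞) ^ n) (by fun_prop)]
      simp only [ih]
  have := h.prob v
  have := h'.prob v
  exact meas_ext _ _ (max R R') ((h.mono (le_max_left _ _)).supp v)
    ((h'.mono (le_max_right _ _)).supp v) fun n => hmom n v

open MeasureTheory in
lemma MSys.step {V : Type u} {p : V → V} {lam : V → ℂ} {R : NNReal}
    {μ : V → Measure NNReal} (h : MSys p lam R μ) (u : V) (g : NNReal → ℝ≥0∞)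
    (hg : Measurable g) :
    ‖lam u‖ₑ ^ 2 * ∫⁻ x, g x ∂(μ u) ≤ ∫⁻ x, (x : ℝ≥0∞) * g x ∂(μ (p u)) := by
  rw [h.lint (p u) g hg]
  refine le_trans ?_ (ENNReal.le_tsum u)
  simp

open MeasureTheory in
lemma MSys.path {V : Type u} {p : V → V} {lam : V → ℂ} {R : NNReal}
    {μ : V → Measure NNReal} (h : MSys p lam R μ) (j : ℕ) (v : V)
    (hv : ∀ i < j, lam (p^[i] v) ≠ 0) :
    ∃ c : ℝ≥0∞, c ≠ 0 ∧ ∀ g : NNReal → ℝ≥0∞, Measurable g →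
      c * ∫⁻ x, g x ∂(μ v) ≤ ∫⁻ x, (x : ℝ≥0∞) ^ j * g x ∂(μ (p^[j] v)) := by
  induction j with
  | zero => exact ⟨1, one_ne_zero, fun g hg => by simp⟩
  | succ j ih =>
    obtain ⟨c, hc, hg⟩ := ih fun i hi => hv i (by omega)
    refine ⟨‖lam (p^[j] v)‖ₑ ^ 2 * c, mul_ne_zero (by simpa using hv j (by omega)) hc, ?_⟩
    intro g hgm
    rw [mul_assoc]
    refine (mul_le_mul_right (hg g hgm) _).trans ?_
    refine (h.step _ _ (by fun_prop)).trans ?_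
    rw [Function.iterate_succ_apply']
    simp only [pow_succ', mul_assoc, le_refl]

open MeasureTheory in
lemma MSys.path_inv {V : Type u} {p : V → V} {lam : V → ℂ} {R : NNReal}
    {μ : V → Measure NNReal} (h : MSys p lam R μ) (j : ℕ) (v : V)
    (hv : ∀ i < j, lam (p^[i] v) ≠ 0) :
    ∫⁻ x, ((x : ℝ≥0∞)⁻¹) ^ j ∂(μ v) < ∞ := by
  obtain ⟨c, hc, hg⟩ := h.path j v hv
  have h1 := hg (fun x => ((x : ℝ≥0∞)⁻¹) ^ j) (by fun_prop)
  have hp := h.prob (p^[j] v)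
  have h2 : ∫⁻ x, (x : ℝ≥0∞) ^ j * ((x : ℝ≥0∞)⁻¹) ^ j ∂(μ (p^[j] v)) ≤ 1 := by
    calc _ ≤ ∫⁻ x, 1 ∂(μ (p^[j] v)) := by
          refine lintegral_mono fun x => ?_
          rw [← mul_pow]
          exact pow_le_one₀ (zero_le) (ENNReal.mul_inv_le_one _)
      _ = 1 := by simp
  by_contra hcon
  rw [not_lt, top_le_iff] at hcon
  rw [hcon, ENNReal.mul_top hc] at h1
  exact absurd (h1.trans h2) (by simp)


/-- `d` is the depth function of the tree rooted at `ω` -/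
def IsDepth {V : Type u} (p : V → V) (ω : V) (d : V → ℕ) : Prop :=
  ∀ w n, p^[n] w = ω ↔ d w ≤ n

lemma exists_depth {V : Type u} {p : V → V} (htree : IsDirectedTree p) {ω : V} (hω : p ω = ω) :
    ∃ d : V → ℕ, IsDepth p ω d := by
  have hfix : ∀ n, p^[n] ω = ω := fun n => Function.iterate_fixed hω n
  have hex : ∀ w, ∃ n, p^[n] w = ω := by
    intro w
    obtain ⟨m, n, h⟩ := htree.2 w ω
    exact ⟨m, by rw [h, hfix]⟩
  refine ⟨fun w => Nat.find (hex w), fun w n => ⟨fun h => Nat.find_min' _ h, fun h => ?_⟩⟩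
  have h1 := Nat.find_spec (hex w)
  obtain ⟨m, rfl⟩ := Nat.exists_eq_add_of_le h
  rw [add_comm, Function.iterate_add_apply, h1, hfix]

lemma IsDepth.iter {V : Type u} {p : V → V} {ω : V} {d : V → ℕ} (h : IsDepth p ω d) (w : V)
    (n : ℕ) : d (p^[n] w) = d w - n := by
  have h1 : ∀ m, d (p^[n] w) ≤ m ↔ d w ≤ m + n := by
    intro m
    rw [← h, ← h, Function.iterate_add_apply]
  have h2 := (h1 (d (p^[n] w))).1 le_rfl
  have h3 := (h1 (d w - n)).2 (by omega)
  omega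

lemma IsDepth.parent {V : Type u} {p : V → V} {ω : V} {d : V → ℕ} (h : IsDepth p ω d) (w : V) :
    d (p w) = d w - 1 := h.iter w 1

lemma IsDepth.zero {V : Type u} {p : V → V} {ω : V} {d : V → ℕ} (h : IsDepth p ω d) (w : V) :
    d w = 0 ↔ w = ω := by
  have := h w 0
  simp only [Function.iterate_zero, id, Nat.le_zero] at this
  exact this.symm

lemma IsDepth.root {V : Type u} {p : V → V} {ω : V} {d : V → ℕ} (h : IsDepth p ω d)
    (hω : p ω = ω) (w : V) : p w = w ↔ w = ω := by
  constructor
  · intro hw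
    have := h.parent w
    rw [hw] at this
    rw [← h.zero]; omega
  · rintro rfl; exact hω

lemma IsDepth.childrenIter {V : Type u} {p : V → V} {ω : V} {d : V → ℕ} (h : IsDepth p ω d)
    (k : ℕ) (w : V) : w ∈ childrenIter p k ω ↔ d w = k := by
  cases k with
  | zero => rw [h.zero]; simp [ShiftsPaper.childrenIter]
  | succ k =>
    change (p^[k + 1] w = ω ∧ p^[k] w ≠ ω) ↔ _
    rw [h, Ne, h]; omega

lemma mem_des {V : Type u} (p : V → V) (u v : V) : u ∈ des p v ↔ ∃ n, p^[n] u = v := by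
  constructor
  · intro h
    obtain ⟨n, hn⟩ := Set.mem_iUnion.1 h
    cases n with
    | zero => exact ⟨0, hn⟩
    | succ n => exact ⟨n + 1, hn.1⟩
  · intro h
    refine Set.mem_iUnion.2 ⟨Nat.find h, ?_⟩
    have h1 := Nat.find_spec h
    have h2 := fun m => Nat.find_min h (m := m)
    generalize Nat.find h = n at h1 h2
    cases n with
    | zero => exact h1
    | succ n => exact ⟨h1, h2 n (by omega)⟩

lemma IsDepth.mem_des {V : Type u} {p : V → V} {ω : V} {d : V → ℕ} (h : IsDepth p ω d)
    {k : ℕ} (hk : 1 ≤ k) {v : V} (hv : d v = k) (w : V) :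
    w ∈ des p v ↔ k ≤ d w ∧ p^[d w - k] w = v := by
  rw [ShiftsPaper.mem_des]
  constructor
  · rintro ⟨n, hn⟩
    have := h.iter w n
    rw [hn] at this
    refine ⟨by omega, ?_⟩
    rw [← hn]
    congr 1; omega
  · rintro ⟨_, h2⟩
    exact ⟨_, h2⟩

lemma IsDepth.parent_mem_des {V : Type u} {p : V → V} {ω : V} {d : V → ℕ} (h : IsDepth p ω d)
    {k : ℕ} (hk : 1 ≤ k) {v : V} (hv : d v = k) (u : V) :
    p u ∈ des p v ↔ u ∈ des p v ∧ u ≠ v := by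
  rw [h.mem_des hk hv, h.mem_des hk hv, h.parent, ← Function.iterate_succ_apply]
  constructor
  · rintro ⟨h1, h2⟩
    have e : (d u - 1 - k).succ = d u - k := by omega
    rw [e] at h2
    exact ⟨⟨by omega, h2⟩, by rintro rfl; omega⟩
  · rintro ⟨⟨h1, h2⟩, h3⟩
    have : d u ≠ k := by
      intro h4
      rw [h4, Nat.sub_self] at h2
      exact h3 h2
    have e : (d u - 1 - k).succ = d u - k := by omega
    rw [e]
    exact ⟨by omega, h2⟩

lemma transfer {V : Type u} {p : V → V} {v : V} {E : Set V}
    (hE : ∀ u, p u ∈ E ↔ u ∈ E ∧ u ≠ v) (lam : V → ℂ) (f : V → ℝ≥0∞) (w : E) :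
    (∑' u : E, @ite _ (restrictParent p E u = w) (Classical.propDecidable _)
      (‖subWeights lam v E u‖ₑ ^ 2 * f u) 0) =
      ∑' u, if p u = w then ‖lam u‖ₑ ^ 2 * f u else 0 := by
  have h2 : Function.support (fun u => if p u = (w : V) then ‖lam u‖ₑ ^ 2 * f u else 0) ⊆ E := by
    intro u hu
    rw [Function.mem_support] at hu
    by_cases hp : p u = w
    · exact ((hE u).1 (hp ▸ w.2)).1
    · simp [hp] at hu
  rw [← tsum_subtype_eq_of_support_subset h2]
  congr 1; ext u
  by_cases huv : (u : V) = v
  · have h3 : p u ≠ w := by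
      intro h4
      exact ((hE u).1 (h4 ▸ w.2)).2 huv
    simp [subWeights, huv]
    intro h5; rw [huv] at h3; exact absurd h5 h3
  · have h3 : p u ∈ E := (hE u).2 ⟨u.2, huv⟩
    simp only [restrictParent, h3, subWeights, huv, dif_pos, if_false, Subtype.ext_iff]

lemma sub_proper {V : Type u} {p : V → V} {v : V} {E : Set V}
    (hE : ∀ u, p u ∈ E ↔ u ∈ E ∧ u ≠ v) (lam : V → ℂ) (hlam : ∀ u ∈ E, u ≠ v → lam u ≠ 0)
    (hroot : ∀ u ∈ E, p u ≠ u) :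
    ProperWeights (restrictParent p E) (subWeights lam v E) := by
  intro u
  by_cases huv : (u : V) = v
  · have : p u ∉ E := fun h => ((hE u).1 h).2 huv
    simp [restrictParent, subWeights, huv]
    intro h; rw [huv] at this; exact absurd h this
  · have h3 : p u ∈ E := (hE u).2 ⟨u.2, huv⟩
    simp [restrictParent, subWeights, huv, h3, hlam u u.2 huv, Subtype.ext_iff, hroot u u.2]

open MeasureTheory in
/-- the measure `x^{-j} dm` -/
def invM (m : Measure NNReal) (j : ℕ) : Measure NNReal :=
  m.withDensity fun x => ((x : ℝ≥0∞)⁻¹) ^ j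

open MeasureTheory in
lemma invM_zero (m : Measure NNReal) : invM m 0 = m := by
  simp only [invM, pow_zero]
  exact withDensity_one

open MeasureTheory in
lemma invM_univ (m : Measure NNReal) (j : ℕ) :
    invM m j Set.univ = ∫⁻ x, ((x : ℝ≥0∞)⁻¹) ^ j ∂m := by
  simp [invM]

open MeasureTheory in
lemma invM_supp (m : Measure NNReal) (j : ℕ) (s : Set NNReal) (h : m s = 0) : invM m j s = 0 :=
  withDensity_absolutelyContinuous _ _ h

open MeasureTheory in
lemma invM_univ_ne_zero (m : Measure NNReal) [IsProbabilityMeasure m] (j : ℕ) :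
    invM m j Set.univ ≠ 0 := by
  rw [invM_univ, Ne, lintegral_eq_zero_iff (by fun_prop)]
  intro h
  have : ∀ᵐ x ∂m, False := by
    filter_upwards [h] with x hx
    have : ((x : ℝ≥0∞)⁻¹) ^ j ≠ 0 := pow_ne_zero _ (by simp)
    exact this hx
  rw [Filter.eventually_false_iff_eq_bot, ae_eq_bot] at this
  exact IsProbabilityMeasure.ne_zero m this

open MeasureTheory in
lemma invM_le (m : Measure NNReal) [IsProbabilityMeasure m] {j k : ℕ} (hj : j ≤ k) :
    invM m j Set.univ ≤ 1 + ∫⁻ x, ((x : ℝ≥0∞)⁻¹) ^ k ∂m := by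
  rw [invM_univ]
  calc ∫⁻ x, ((x : ℝ≥0∞)⁻¹) ^ j ∂m ≤ ∫⁻ x, (1 + ((x : ℝ≥0∞)⁻¹) ^ k) ∂m := by
        refine lintegral_mono fun x => ?_
        rcases le_total ((x : ℝ≥0∞)⁻¹) 1 with h | h
        · exact (pow_le_one₀ (zero_le) h).trans le_self_add
        · exact (pow_le_pow_right₀ h hj).trans le_add_self
    _ = _ := by
        rw [lintegral_add_left (by fun_prop)]; simp

open MeasureTheory in
lemma invM_succ (m : Measure NNReal) {k : ℕ} (hk : 1 ≤ k)
    (hf : ∫⁻ x, ((x : ℝ≥0∞)⁻¹) ^ k ∂m < ∞) (j : ℕ) (s : Set NNReal) (hs : MeasurableSet s) :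
    ∫⁻ x in s, (x : ℝ≥0∞) ∂(invM m (j + 1)) = invM m j s := by
  have h0 : ∀ᵐ x : NNReal ∂m, (x : ℝ≥0∞) ≠ 0 := by
    filter_upwards [ae_lt_top (by fun_prop) hf.ne] with x hx h
    rw [h, ENNReal.inv_zero, ENNReal.top_pow (by omega)] at hx
    exact absurd hx (by simp)
  rw [invM, invM, withDensity_apply _ hs, restrict_withDensity hs,
    lintegral_withDensity_eq_lintegral_mul _ (by fun_prop) (by fun_prop)]
  refine lintegral_congr_ae (ae_restrict_of_ae ?_)
  filter_upwards [h0] with x hx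
  simp only [Pi.mul_apply]
  rw [pow_succ, mul_assoc, ENNReal.inv_mul_cancel hx (by simp), mul_one]

lemma enorm_sqrt (a : ℝ≥0∞) (h : a ≠ ∞) :
    ‖((Real.sqrt a.toReal : ℝ) : ℂ)‖ₑ ^ 2 = a := by
  rw [← ofReal_norm, ← ENNReal.ofReal_pow (norm_nonneg _), Complex.norm_real, Real.norm_eq_abs,
    sq_abs, Real.sq_sqrt ENNReal.toReal_nonneg, ENNReal.ofReal_toReal h]

lemma sqrt_ne (a : ℝ≥0∞) (h : a ≠ ∞) (h0 : a ≠ 0) : ((Real.sqrt a.toReal : ℝ) : ℂ) ≠ 0 := by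
  rw [Complex.ofReal_ne_zero, Real.sqrt_ne_zero']
  exact ENNReal.toReal_pos h0 h

open MeasureTheory in
lemma join_msys {V : Type u} {p : V → V} {ω : V} (hω : p ω = ω) {d : V → ℕ}
    (hd : IsDepth p ω d) (hleafless : Leafless p) {k : ℕ} (hk : 1 ≤ k) (lam : V → ℂ)
    (hlam : ∀ v, p^[k] v ≠ ω → lam v ≠ 0) (hcount : Countable {v // d v = k})
    (R : NNReal) (ν : V → Measure NNReal)
    (hprob : ∀ w, k ≤ d w → IsProbabilityMeasure (ν w))
    (hsupp : ∀ w, k ≤ d w → ν w (Set.Ioi R) = 0)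
    (hrel : ∀ w, k ≤ d w → ∀ s : Set NNReal, MeasurableSet s →
      ∫⁻ x in s, (x : ℝ≥0∞) ∂(ν w) = ∑' u, if p u = w then ‖lam u‖ₑ ^ 2 * ν u s else 0)
    (hfin : ∀ w, d w = k → ∫⁻ x, ((x : ℝ≥0∞)⁻¹) ^ k ∂(ν w) < ∞) :
    ∃ lam' : V → ℂ, (∀ v, p^[k] v ≠ ω → lam' v = lam v) ∧ ProperWeights p lam' ∧
      ∃ μ, MSys p lam' R μ := by
  have hpr : ∀ v : {v // d v = k}, IsProbabilityMeasure (ν v) := fun v => hprob v v.2.ge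
  obtain ⟨a, ha0, ha⟩ := ENNReal.exists_pos_tsum_mul_lt_of_countable one_ne_zero
    (fun v : {v // d v = k} => 1 + ∫⁻ x, ((x : ℝ≥0∞)⁻¹) ^ k ∂(ν v))
    (fun v => by simpa using (hfin v v.2).ne)
  -- unnormalised measures
  let ρ : V → Measure NNReal := fun w => (if w = ω then Measure.dirac 0 else 0) +
    Measure.sum fun v : {v // d v = k} =>
      (if p^[k - d w] v = w then (a v : ℝ≥0∞) else 0) • invM (ν v) (k - d w)
  let t : V → ℝ≥0∞ := fun w => ρ w Set.univ
  have hρ : ∀ w s, MeasurableSet s → ρ w s = (if w = ω then Measure.dirac 0 s else 0) +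
      ∑' v : {v // d v = k}, if p^[k - d w] v = w then (a v : ℝ≥0∞) * invM (ν v) (k - d w) s
        else 0 := by
    intro w s hs
    simp only [ρ, Measure.add_apply, Measure.sum_apply _ hs, Measure.smul_apply, smul_eq_mul,
      ite_mul, zero_mul]
    split_ifs <;> simp
  have htfin : ∀ w, t w ≠ ∞ := by
    intro w
    simp only [t]
    rw [hρ w _ MeasurableSet.univ]
    refine ENNReal.add_ne_top.2 ⟨by split_ifs <;> simp, ?_⟩
    refine ne_top_of_le_ne_top (ha.trans ENNReal.one_lt_top).ne (ENNReal.tsum_le_tsum fun v => ?_)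
    split_ifs
    · rw [mul_comm]
      exact mul_le_mul_left (invM_le _ (by omega)) _
    · exact zero_le
  have ht0 : ∀ w, d w ≤ k → t w ≠ 0 := by
    intro w hw
    simp only [t]
    rw [hρ w _ MeasurableSet.univ]
    by_cases h0 : w = ω
    · simp [h0]
    · obtain ⟨v, hv⟩ := hleafless.iterate (k - d w) w
      have h1 : d w ≠ 0 := fun h => h0 ((hd.zero w).1 h)
      have h2 : d v = k := by
        have := hd.iter v (k - d w)
        rw [hv] at this; omega
      intro h
      rw [add_eq_zero, ENNReal.tsum_eq_zero] at h
      have h3 := h.2 ⟨v, h2⟩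
      simp only [hv, if_true, mul_eq_zero] at h3
      have := hpr ⟨v, h2⟩
      rcases h3 with h3 | h3
      · exact (ha0 ⟨v, h2⟩).ne' (by simpa using h3)
      · exact invM_univ_ne_zero _ _ h3
  -- at depth `k`
  have hρk : ∀ w (hw : d w = k), ρ w = (a ⟨w, hw⟩ : ℝ≥0∞) • ν w := by
    intro w hw
    have h0 : w ≠ ω := fun h => by
      have := (hd.zero w).2 h
      omega
    ext s hs
    rw [hρ w s hs, tsum_eq_single ⟨w, hw⟩]
    · simp [hw, h0, invM_zero]
    · intro v hv
      rw [if_neg]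
      rw [hw, Nat.sub_self]
      intro h
      exact hv (Subtype.ext h)
  let μ : V → Measure NNReal := fun w => if k ≤ d w then ν w else (t w)⁻¹ • ρ w
  have hμ : ∀ w, d w ≤ k → μ w = (t w)⁻¹ • ρ w := by
    intro w hw
    by_cases h : k ≤ d w
    · have hw' : d w = k := le_antisymm hw h
      have := hprob w h
      have h1 : t w = a ⟨w, hw'⟩ := by
        simp only [t]; rw [hρk w hw']; simp
      simp only [μ, if_pos h]
      rw [h1, hρk w hw', smul_smul, ENNReal.inv_mul_cancel, one_smul]
      · simpa using (ha0 ⟨w, hw'⟩).ne'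
      · simp
    · simp only [μ, if_neg h]
  let lam' : V → ℂ := fun u => if k < d u then lam u else if u = ω then 0 else
    ((Real.sqrt (t u / t (p u)).toReal : ℝ) : ℂ)
  have hq : ∀ u, d u ≤ k → t u / t (p u) ≠ ∞ ∧ t u / t (p u) ≠ 0 := by
    intro u hu
    have h1 : d (p u) ≤ k := by rw [hd.parent]; omega
    exact ⟨ENNReal.div_ne_top (htfin u) (ht0 _ h1), ENNReal.div_ne_zero.2 ⟨ht0 u hu, htfin _⟩⟩
  refine ⟨lam', ?_, ?_, μ, ?_, ?_, ?_⟩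
  · intro v hv
    rw [Ne, hd] at hv
    simp only [lam', if_pos (not_le.1 hv)]
  · intro v
    rw [hd.root hω]
    by_cases h1 : k < d v
    · have h2 : v ≠ ω := fun h => by
        have := (hd.zero v).2 h
        omega
      have h3 := hlam v (by rw [Ne, hd]; omega)
      simp [lam', h1, h2, h3]
    · by_cases h2 : v = ω
      · have h3 : d ω = 0 := (hd.zero ω).2 rfl
        simp [lam', h2]
        omega
      · simp only [lam', h1, h2, if_false, iff_false]
        have := hq v (by omega)
        exact sqrt_ne _ this.1 this.2
  · intro w
    by_cases h : k ≤ d w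
    · simp only [μ, if_pos h]; exact hprob w h
    · rw [hμ w (by omega)]
      refine ⟨?_⟩
      simp only [Measure.smul_apply, smul_eq_mul]
      exact ENNReal.inv_mul_cancel (ht0 w (by omega)) (htfin w)
  · intro w
    by_cases h : k ≤ d w
    · simp only [μ, if_pos h]; exact hsupp w h
    · rw [hμ w (by omega)]
      simp only [Measure.smul_apply, smul_eq_mul]
      rw [hρ w _ measurableSet_Ioi]
      have : ∀ v : {v // d v = k}, invM (ν v) (k - d w) (Set.Ioi R) = 0 := fun v =>
        invM_supp _ _ _ (hsupp v v.2.ge)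
      simp [this]
  · intro w s hs
    by_cases h : k ≤ d w
    · have e1 : μ w = ν w := by simp only [μ, if_pos h]
      rw [e1, hrel w h s hs]
      congr 1; ext u
      by_cases hu : p u = w
      · have h1 : k < d u := by
          have := hd.parent u
          rw [hu] at this; omega
        simp [hu, lam', μ, h1, h1.le]
      · simp [hu]
    · push Not at h
      have e2 : ∀ u, (if p u = w then ‖lam' u‖ₑ ^ 2 * μ u s else 0) =
          (t w)⁻¹ * if p u = w ∧ u ≠ ω then ρ u s else 0 := by
        intro u
        by_cases hu : p u = w
        · have h1 : d u ≤ k := by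
            have := hd.parent u
            rw [hu] at this; omega
          by_cases h2 : u = ω
          · have : ¬ k < d u := by omega
            simp [lam', h2] at this ⊢
            intro _
            left
            intro h3
            omega
          · simp only [hu, h2, lam', not_lt.2 h1, if_false, if_true, ne_eq, not_false_eq_true,
              and_self]
            have h3 := hq u h1
            rw [hu] at h3
            rw [enorm_sqrt _ h3.1, hμ u h1, Measure.smul_apply, smul_eq_mul, ← mul_assoc,
              div_eq_mul_inv, mul_comm (t u), mul_assoc (t w)⁻¹,
              ENNReal.mul_inv_cancel (ht0 u h1) (htfin u), mul_one]
        · simp [hu]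
      simp only [e2]
      rw [ENNReal.tsum_mul_left, hμ w h.le, Measure.restrict_smul, lintegral_smul_measure,
        smul_eq_mul]
      congr 1
      obtain ⟨j, hj⟩ : ∃ j, k - d w = j + 1 := ⟨k - d w - 1, by omega⟩
      -- left side
      have l1 : ∫⁻ x in s, (x : ℝ≥0∞) ∂(ρ w) = ∑' v : {v // d v = k},
          if p^[j + 1] v = w then (a v : ℝ≥0∞) * invM (ν v) j s else 0 := by
        simp only [ρ]
        rw [Measure.restrict_add, lintegral_add_measure, Measure.restrict_sum _ hs,
          lintegral_sum_measure, hj]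
        have z : ∫⁻ x in s, (x : ℝ≥0∞) ∂(if w = ω then Measure.dirac 0 else 0) = 0 := by
          refine nonpos_iff_eq_zero.1 ((setLIntegral_le_lintegral _ _).trans ?_)
          split_ifs
          · rw [lintegral_dirac]; simp
          · simp
        rw [z, zero_add]
        congr 1; ext v
        rw [Measure.restrict_smul, lintegral_smul_measure, invM_succ _ hk (hfin v v.2) j s hs]
        split_ifs <;> simp
      have l2 : ∀ u, (if p u = w ∧ u ≠ ω then ρ u s else 0) = ∑' v : {v // d v = k},
          if p^[j] v = u then (if p u = w then (a v : ℝ≥0∞) * invM (ν v) j s else 0) else 0 := by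
        intro u
        by_cases hu : p u = w
        · by_cases h2 : u = ω
          · rw [if_neg (by tauto)]
            symm
            rw [ENNReal.tsum_eq_zero]
            intro v
            rw [if_neg]
            intro h3
            have := hd.iter v j
            rw [h3, v.2, h2, (hd.zero ω).2 rfl] at this
            omega
          · have h3 : d u ≠ 0 := fun h => h2 ((hd.zero u).1 h)
            have h4 : k - d u = j := by
              have := hd.parent u
              rw [hu] at this
              omega
            rw [if_pos ⟨hu, h2⟩, hρ u s hs, if_neg h2, h4, zero_add]
            simp only [hu, if_true]
        · simp [hu]
      rw [l1]
      simp only [l2]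
      rw [ENNReal.tsum_comm]
      congr 1; ext v
      rw [tsum_ite_eq' (p^[j] (v : V))
        (fun u => if p u = w then (a v : ℝ≥0∞) * invM (ν v) j s else 0),
        Function.iterate_succ_apply']

lemma ext_inl_iff {V : Type u} (p : V → V) (ω : V) {k : ℕ} (hk : 1 ≤ k) (u w : V) :
    extParent p ω k (Sum.inl u) = Sum.inl w ↔ u ≠ ω ∧ p u = w := by
  have hk' : 0 < k := hk
  by_cases h : u = ω <;> simp [extParent, h, hk']

lemma ext_inr_ne {V : Type u} (p : V → V) (ω : V) {k : ℕ} (j : Fin k) (w : V) :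
    extParent p ω k (Sum.inr j) ≠ Sum.inl w := by
  simp only [extParent]
  split_ifs <;> simp

/-- sum over the children of an old vertex in the backward extension -/
lemma ext_tsum_inl {V : Type u} (p : V → V) (lam : V → ℂ) (ω : V) (hlam : lam ω = 0) {k : ℕ}
    (hk : 1 ≤ k) (mu : Fin k → ℂ) (f : V ⊕ Fin k → ℝ≥0∞) (w : V) :
    (∑' b, @ite _ (extParent p ω k b = Sum.inl w) (Classical.propDecidable _)
      (‖extWeights lam ω k mu b‖ₑ ^ 2 * f b) 0) =
      ∑' u, if p u = w then ‖lam u‖ₑ ^ 2 * f (Sum.inl u) else 0 := by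
  rw [← Function.Injective.tsum_eq (Sum.inl_injective (α := V) (β := Fin k))]
  · congr 1; ext u
    simp only [ext_inl_iff p ω hk]
    by_cases h : u = ω
    · simp [h, hlam]
    · simp [h, extWeights]
  · intro b hb
    rw [Function.mem_support] at hb
    cases b with
    | inl u => exact ⟨u, rfl⟩
    | inr j => simp [ext_inr_ne] at hb

/-- the vertex preceding `ω_{j+1}` -/
def extPrev {V : Type u} (ω : V) (k : ℕ) (j : Fin k) : V ⊕ Fin k :=
  if h : (j : ℕ) = 0 then Sum.inl ω else Sum.inr ⟨(j : ℕ) - 1, by omega⟩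

lemma ext_tsum_inr {V : Type u} (p : V → V) (lam : V → ℂ) (ω : V) {k : ℕ}
    (mu : Fin k → ℂ) (f : V ⊕ Fin k → ℝ≥0∞) (j : Fin k) :
    (∑' b, @ite _ (extParent p ω k b = Sum.inr j) (Classical.propDecidable _)
      (‖extWeights lam ω k mu b‖ₑ ^ 2 * f b) 0) =
      ‖mu j‖ₑ ^ 2 * f (extPrev ω k j) := by
  obtain ⟨j, hj⟩ := j
  rw [tsum_eq_single (extPrev ω k ⟨j, hj⟩)]
  · have hk : 0 < k := by omega
    by_cases h : j = 0
    · subst h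
      simp [extPrev, extParent, extWeights, hk]
    · have e : j - 1 + 1 = j := by omega
      simp [extPrev, h, extParent, extWeights, e, hj]
  · intro b hb
    cases b with
    | inl u =>
      by_cases hu : u = ω
      · by_cases h : j = 0
        · exact absurd (by simp [extPrev, h, hu]) hb
        · rw [if_neg]
          have hk : 0 < k := by omega
          simp [extParent, hu, hk]
          omega
      · rw [if_neg]
        simp [extParent, hu]
    | inr i =>
      obtain ⟨i, hi⟩ := i
      by_cases h : i + 1 < k
      · rw [if_neg]
        simp only [extParent, h, dif_pos, Sum.inr.injEq, Fin.mk.injEq]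
        intro h2
        subst h2
        apply hb
        simp [extPrev]
      · simp [extWeights, h]

open MeasureTheory in
lemma back_ext {V : Type u} {p : V → V} {lam : V → ℂ} {ω : V} (hlam : lam ω = 0)
    {k : ℕ} (hk : 1 ≤ k) {R : NNReal} {μ : V → Measure NNReal} (h : MSys p lam R μ)
    (hf : ∫⁻ x, ((x : ℝ≥0∞)⁻¹) ^ k ∂(μ ω) < ∞) :
    ∃ mu : Fin k → ℂ, (∀ j, mu j ≠ 0) ∧
      ∃ μ', MSys (extParent p ω k) (extWeights lam ω k mu) R μ' := by
  have hpω := h.prob ω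
  let m : ℕ → ℝ≥0∞ := fun j => invM (μ ω) j Set.univ
  have hm0 : ∀ j, m j ≠ 0 := fun j => invM_univ_ne_zero _ j
  have hmt : ∀ j ≤ k, m j ≠ ∞ := fun j hj =>
    ((invM_le (μ ω) hj).trans_lt (ENNReal.add_lt_top.2 ⟨ENNReal.one_lt_top, hf⟩)).ne
  let κ : ℕ → Measure NNReal := fun j => (m j)⁻¹ • invM (μ ω) j
  have hκ0 : κ 0 = μ ω := by
    simp [κ, m, invM_zero]
  let mu : Fin k → ℂ := fun j => ((Real.sqrt (m j / m (j + 1)).toReal : ℝ) : ℂ)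
  have hq : ∀ j : Fin k, m j / m (j + 1) ≠ ∞ ∧ m j / m (j + 1) ≠ 0 := fun j =>
    ⟨ENNReal.div_ne_top (hmt j (by omega)) (hm0 _),
      ENNReal.div_ne_zero.2 ⟨hm0 _, hmt _ (by omega)⟩⟩
  let μ' : V ⊕ Fin k → Measure NNReal := Sum.elim μ fun j => κ (j + 1)
  refine ⟨mu, fun j => sqrt_ne _ (hq j).1 (hq j).2, μ', ?_, ?_, ?_⟩
  · rintro (w | j)
    · exact h.prob w
    · refine ⟨?_⟩
      simp only [μ', Sum.elim_inr, κ, Measure.smul_apply, smul_eq_mul]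
      exact ENNReal.inv_mul_cancel (hm0 _) (hmt _ (by omega))
  · rintro (w | j)
    · exact h.supp w
    · simp only [μ', Sum.elim_inr, κ, Measure.smul_apply, smul_eq_mul]
      rw [invM_supp _ _ _ (h.supp ω), mul_zero]
  · rintro (w | j) s hs
    · rw [ext_tsum_inl p lam ω hlam hk mu (fun b => μ' b s) w]
      exact h.rel w s hs
    · rw [ext_tsum_inr p lam ω mu (fun b => μ' b s) j]
      have e1 : μ' (extPrev ω k j) = κ j := by
        by_cases h0 : (j : ℕ) = 0
        · simp [extPrev, h0, μ', hκ0]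
        · have e : (j : ℕ) - 1 + 1 = j := by omega
          simp [extPrev, h0, μ', e]
      rw [e1]
      simp only [mu]
      rw [enorm_sqrt _ (hq j).1]
      simp only [μ', Sum.elim_inr, κ]
      rw [Measure.restrict_smul, lintegral_smul_measure, invM_succ _ hk hf _ _ hs,
        Measure.smul_apply, smul_eq_mul, smul_eq_mul, div_eq_mul_inv, mul_comm (m j), mul_assoc,
        ← mul_assoc (m j), ENNReal.mul_inv_cancel (hm0 _) (hmt _ (by omega)), one_mul]

lemma ext_iter {V : Type u} (p : V → V) (ω : V) {k : ℕ} (i : ℕ) (hi : i < k) :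
    (extParent p ω k)^[i + 1] (Sum.inl ω) = Sum.inr ⟨i, hi⟩ := by
  induction i with
  | zero => simp [extParent, hi]
  | succ i ih =>
    rw [Function.iterate_succ_apply', ih (by omega)]
    simp [extParent, hi]

open MeasureTheory in
lemma of_back_ext {V : Type u} {p : V → V} {lam : V → ℂ} {ω : V} (hlam : lam ω = 0)
    {k : ℕ} (hk : 1 ≤ k) {R R' : NNReal} {μ : V → Measure NNReal} (h : MSys p lam R μ)
    {mu : Fin k → ℂ} (hmu : ∀ j, mu j ≠ 0) {μ' : V ⊕ Fin k → Measure NNReal}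
    (h' : MSys (extParent p ω k) (extWeights lam ω k mu) R' μ') :
    ∫⁻ x, ((x : ℝ≥0∞)⁻¹) ^ k ∂(μ ω) < ∞ := by
  have h1 : MSys p lam R' fun w => μ' (Sum.inl w) := by
    refine ⟨fun w => h'.prob _, fun w => h'.supp _, fun w s hs => ?_⟩
    rw [h'.rel _ s hs, ext_tsum_inl p lam ω hlam hk mu (fun b => μ' b s) w]
  rw [h.unique h1 ω]
  refine h'.path_inv k (Sum.inl ω) fun i hi => ?_
  cases i with
  | zero =>
    have hk' : 0 < k := hk
    simp [extWeights, hk', hmu]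
  | succ i =>
    rw [ext_iter p ω i (by omega)]
    simp [extWeights, hi, hmu]

open MeasureTheory in
lemma MSys.countable {V : Type u} {p : V → V} {lam : V → ℂ} {R : NNReal}
    {μ : V → Measure NNReal} (h : MSys p lam R μ) (w : V) :
    {u | p u = w ∧ lam u ≠ 0}.Countable := by
  have h1 := h.rel w Set.univ MeasurableSet.univ
  have hw := h.prob w
  have h2 : (∑' u, if p u = w then ‖lam u‖ₑ ^ 2 * μ u Set.univ else 0) ≠ ∞ := by
    rw [← h1, Measure.restrict_univ]
    refine ne_top_of_le_ne_top ?_ (lint_le_supp _ R (h.supp w))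
    simp
  refine (Summable.countable_support_ennreal h2).mono ?_
  rintro u ⟨hu, hl⟩
  have := h.prob u
  simp [hu, hl]

theorem joinSub_mp {V : Type u} (p : V → V) (htree : IsDirectedTree p)
    (ω : V) (hω : p ω = ω) (k : ℕ) (hk : 1 ≤ k) (lam : V → ℂ)
    (lam' : V → ℂ) (hl : ∀ v : V, p^[k] v ≠ ω → lam' v = lam v) (hproper : ProperWeights p lam')
    (S : Hs V →L[ℂ] Hs V) (hS : IsWeightedShift p lam' S) (hsub : Subnormal S) :
      ((childrenIter p k ω).Countable ∧
        ∃ C : ℝ,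
          ∀ v : V, v ∈ childrenIter p k ω →
            ∃ Sv : Hs ↥(des p v) →L[ℂ] Hs ↥(des p v),
              IsWeightedShift (restrictParent p (des p v))
                (subWeights lam v (des p v)) Sv ∧
              ProperWeights (restrictParent p (des p v))
                (subWeights lam v (des p v)) ∧
              ‖Sv‖ ≤ C ∧
              AdmitsSubnormalBackExt (restrictParent p (des p v))
                (subWeights lam v (des p v)) ⟨v, self_mem_des p v⟩ Sv k) := by
  obtain ⟨d, hd⟩ := exists_depth htree hω
  obtain ⟨μ, h⟩ := exists_msys hS hsub
  set R : NNReal := ‖S‖₊ ^ 2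
  have hne : ∀ u, u ≠ ω → lam' u ≠ 0 := fun u hu h0 => hu ((hd.root hω u).1 ((hproper u).1 h0))
  have hc : ∀ n, {u | d u = n}.Countable := by
    intro n
    induction n with
    | zero =>
      refine (Set.countable_singleton ω).mono fun u hu => ?_
      exact (hd.zero u).1 hu
    | succ n ih =>
      refine (ih.biUnion fun w _ => h.countable w).mono fun u hu => ?_
      have hu' : d u = n + 1 := hu
      refine Set.mem_biUnion (x := p u) ?_ ⟨rfl, hne u ?_⟩
      · change d (p u) = n
        rw [hd.parent]; omega
      · rintro rfl
        rw [(hd.zero u).2 rfl] at hu'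
        omega
  refine ⟨(hc k).mono fun v hv => (hd.childrenIter k v).1 hv, (NNReal.sqrt R : NNReal), ?_⟩
  intro v hv
  have hdv : d v = k := (hd.childrenIter k v).1 hv
  have hE := fun u => hd.parent_mem_des hk hdv u
  have hdeep : ∀ u ∈ des p v, u ≠ v → lam' u = lam u ∧ u ≠ ω := by
    intro u hu huv
    have h1 := ((hd.mem_des hk hdv _).1 ((hE u).2 ⟨hu, huv⟩)).1
    rw [hd.parent] at h1
    refine ⟨hl u (by rw [Ne, hd]; omega), ?_⟩
    rintro rfl
    rw [(hd.zero u).2 rfl] at h1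
    omega
  have hvω : v ≠ ω := by
    rintro rfl
    rw [(hd.zero v).2 rfl] at hdv
    omega
  have hsw : subWeights lam' v (des p v) = subWeights lam v (des p v) := by
    ext u
    by_cases huv : (u : V) = v
    · simp [subWeights, huv]
    · simp [subWeights, huv, (hdeep u u.2 huv).1]
  have hM : MSys (restrictParent p (des p v)) (subWeights lam v (des p v)) R
      fun u => μ u := by
    refine ⟨fun u => h.prob _, fun u => h.supp _, fun w s hs => ?_⟩
    rw [h.rel w s hs, ← hsw, transfer hE lam' (fun u => μ u s) w]
  obtain ⟨Sv, hSv, hn, hsubv⟩ := hM.exists_subnormal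
  refine ⟨Sv, hSv, ?_, hn, hsubv, ?_⟩
  · refine sub_proper hE lam (fun u hu huv => ?_) fun u hu hr => ?_
    · rw [← (hdeep u hu huv).1]
      exact hne u (hdeep u hu huv).2
    · rw [hd.root hω] at hr
      by_cases huv : u = v
      · exact hvω (huv ▸ hr)
      · exact (hdeep u hu huv).2 hr
  · have hfin : ∫⁻ x, ((x : ℝ≥0∞)⁻¹) ^ k ∂(μ v) < ∞ := by
      refine h.path_inv k v fun i hi => hne _ ?_
      rw [Ne, hd]; omega
    obtain ⟨mu, hmu, μ', h'⟩ := back_ext (ω := ⟨v, self_mem_des p v⟩)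
      (by simp [subWeights]) hk hM hfin
    obtain ⟨S', hS', _, hsub'⟩ := h'.exists_subnormal
    exact ⟨mu, hmu, S', hS', hsub'⟩

open MeasureTheory in
theorem joinSub_mpr {V : Type u} (p : V → V) (htree : IsDirectedTree p)
    (ω : V) (hω : p ω = ω) (hleafless : Leafless p)
    (k : ℕ) (hk : 1 ≤ k)
    (lam : V → ℂ) (hlam : ∀ v : V, p^[k] v ≠ ω → lam v ≠ 0)
    (hcount : (childrenIter p k ω).Countable) (C : ℝ)
    (hC : ∀ v : V, v ∈ childrenIter p k ω →
            ∃ Sv : Hs ↥(des p v) →L[ℂ] Hs ↥(des p v),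
              IsWeightedShift (restrictParent p (des p v))
                (subWeights lam v (des p v)) Sv ∧
              ProperWeights (restrictParent p (des p v))
                (subWeights lam v (des p v)) ∧
              ‖Sv‖ ≤ C ∧
              AdmitsSubnormalBackExt (restrictParent p (des p v))
                (subWeights lam v (des p v)) ⟨v, self_mem_des p v⟩ Sv k) :
    ∃ lam' : V → ℂ,
        (∀ v : V, p^[k] v ≠ ω → lam' v = lam v) ∧
        ProperWeights p lam' ∧
        ∃ S : Hs V →L[ℂ] Hs V, IsWeightedShift p lam' S ∧ Subnormal S := by
  obtain ⟨d, hd⟩ := exists_depth htree hω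
  let R : NNReal := C.toNNReal ^ 2
  have key : ∀ v : V, ∃ N : V → Measure NNReal, d v = k →
      (∀ w ∈ des p v, IsProbabilityMeasure (N w) ∧ N w (Set.Ioi R) = 0 ∧
        ∀ s : Set NNReal, MeasurableSet s → ∫⁻ x in s, (x : ℝ≥0∞) ∂(N w) =
          ∑' u, if p u = w then ‖lam u‖ₑ ^ 2 * N u s else 0) ∧
      ∫⁻ x, ((x : ℝ≥0∞)⁻¹) ^ k ∂(N v) < ∞ := by
    intro v
    by_cases hdv : d v = k
    · obtain ⟨Sv, hSv, _, hn, hsub, mu, hmu, S', hS', hsub'⟩ := hC v ((hd.childrenIter k v).2 hdv)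
      have hE := fun u => hd.parent_mem_des hk hdv u
      obtain ⟨μ, hμ⟩ := exists_msys hSv hsub
      obtain ⟨μ', hμ'⟩ := exists_msys hS' hsub'
      have hR : ‖Sv‖₊ ^ 2 ≤ R := by
        simp only [R]
        gcongr
        exact NNReal.le_toNNReal_of_coe_le hn
      have hfin := of_back_ext (ω := ⟨v, self_mem_des p v⟩) (by simp [subWeights]) hk hμ hmu hμ'
      let N : V → Measure NNReal := fun w => if hw : w ∈ des p v then μ ⟨w, hw⟩ else 0
      have hN : ∀ w : des p v, N w = μ w := by
        intro w
        simp only [N, dif_pos w.2]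
      refine ⟨N, fun _ => ⟨fun w hw => ?_, ?_⟩⟩
      · have e := hN ⟨w, hw⟩
        simp only at e
        rw [e]
        refine ⟨hμ.prob _, (hμ.mono hR).supp _, fun s hs => ?_⟩
        rw [hμ.rel _ s hs, ← transfer hE lam (fun u => N u s) ⟨w, hw⟩]
        refine tsum_congr fun u => ?_
        rw [hN]
      · have e := hN ⟨v, self_mem_des p v⟩
        simp only at e
        rw [e]; exact hfin
    · exact ⟨fun _ => 0, fun h => absurd h hdv⟩
  choose N hN using key
  let anc : V → V := fun w => p^[d w - k] w
  have hanc : ∀ w, k ≤ d w → d (anc w) = k ∧ w ∈ des p (anc w) := by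
    intro w hw
    refine ⟨?_, (mem_des p _ _).2 ⟨_, rfl⟩⟩
    simp only [anc]
    rw [hd.iter]; omega
  have hancp : ∀ u, k ≤ d (p u) → anc u = anc (p u) := by
    intro u hu
    rw [hd.parent] at hu
    simp only [anc]
    rw [hd.parent, ← Function.iterate_succ_apply]
    congr 1; omega
  obtain ⟨lam', h1, h2, μ, hμ⟩ := join_msys hω hd hleafless hk lam hlam
    ((hcount.mono fun v hv => (hd.childrenIter k v).2 hv : {v | d v = k}.Countable).to_subtype)
    R (fun w => N (anc w) w)
    (fun w hw => ((hN _ (hanc w hw).1).1 w (hanc w hw).2).1)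
    (fun w hw => ((hN _ (hanc w hw).1).1 w (hanc w hw).2).2.1)
    (fun w hw s hs => by
      rw [((hN _ (hanc w hw).1).1 w (hanc w hw).2).2.2 s hs]
      congr 1; ext u
      by_cases hu : p u = w
      · rw [if_pos hu, if_pos hu, hancp u (hu ▸ hw), hu]
      · rw [if_neg hu, if_neg hu])
    (fun w hw => by
      have e : anc w = w := by simp [anc, hw]
      rw [e]
      exact (hN w hw).2)
  obtain ⟨S, hS, _, hsub⟩ := hμ.exists_subnormal
  exact ⟨lam', h1, h2, S, hS, hsub⟩

/-- Theorem (join-sub): with `W = {v : p^[k] v ≠ ω}` and nonzero weights prescribed on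
`W`, the remaining weights can be filled in so that the resulting weighted shift on `T`
is proper, bounded and subnormal iff `Chi^⟨k⟩(ω)` is at most countable, every subtree
shift `S_{λ→_v}` (for `v ∈ Chi^⟨k⟩(ω)`) is proper and admits a subnormal `k`-step
backward extension, and the norms of these shifts are uniformly bounded. -/
theorem joinSub {V : Type u} (p : V → V) (htree : IsDirectedTree p)
    (ω : V) (hω : p ω = ω) (hleafless : Leafless p)
    (k : ℕ) (hk : 1 ≤ k)
    (lam : V → ℂ) (hlam : ∀ v : V, p^[k] v ≠ ω → lam v ≠ 0) :
    (∃ lam' : V → ℂ,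
        (∀ v : V, p^[k] v ≠ ω → lam' v = lam v) ∧
        ProperWeights p lam' ∧
        ∃ S : Hs V →L[ℂ] Hs V, IsWeightedShift p lam' S ∧ Subnormal S) ↔
      ((childrenIter p k ω).Countable ∧
        ∃ C : ℝ,
          ∀ v : V, v ∈ childrenIter p k ω →
            ∃ Sv : Hs ↥(des p v) →L[ℂ] Hs ↥(des p v),
              IsWeightedShift (restrictParent p (des p v))
                (subWeights lam v (des p v)) Sv ∧
              ProperWeights (restrictParent p (des p v))
                (subWeights lam v (des p v)) ∧
              ‖Sv‖ ≤ C ∧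
              AdmitsSubnormalBackExt (restrictParent p (des p v))
                (subWeights lam v (des p v)) ⟨v, self_mem_des p v⟩ Sv k) := by
  constructor
  · rintro ⟨lam', hl, hproper, S, hS, hsub⟩
    exact joinSub_mp p htree ω hω k hk lam lam' hl hproper S hS hsub
  · rintro ⟨hcount, C, hC⟩
    exact joinSub_mpr p htree ω hω hleafless k hk lam hlam hcount C hC

end ShiftsPaper
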